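/- arXiv:2104.10783 — 5 statements merged into one kernel-verified Lean document; each statement's English description precedes it below -/
import Mathlib

section
/- Let R be a commutative Noetherian ring and L an R-module. Then Ext^1(F, S^0(L)) = 0 for every F-totally acyclic complex of flats F (Ext^1 computed in the abelian category Ch(R) of chain complexes of R-modules) if and only if L is Gorenstein cotorsion. -/
/-!
STATEMENT 10: Let `R` be a commutative Noetherian ring and `L` an `R`-module.  Then
`Ext¹(F, S⁰ L) = 0` in `Ch(R)` for every F-totally acyclic complex of flats `F` if and
only if `L` is Gorenstein cotorsion.

The vanishing of the (Yoneda) group `Ext¹(A, B)` is expressed by the (equivalent)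
statement that every short exact sequence `0 → B → E → A → 0` splits.
-/

universe u

open CategoryTheory MonoidalCategory Limits

/-- Vanishing of (Yoneda) `Ext¹(A, B)` in an abelian category: every short exact
sequence `0 → B → E → A → 0` splits. -/
def Ext1Vanishes {C : Type*} [Category C] [Abelian C] (A B : C) : Prop :=
  ∀ (E : C) (f : B ⟶ E) (g : E ⟶ A) (w : f ≫ g = 0),
    (ShortComplex.mk f g w).ShortExact → ∃ s : A ⟶ E, s ≫ g = 𝟙 A

variable {R : Type u} [CommRing R]

/-- An `R`-module `M` is cotorsion if `Ext¹_R(F, M) = 0` for every flat `R`-module `F`. -/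
def IsCotorsionModule (M : ModuleCat.{u} R) : Prop :=
  ∀ F : ModuleCat.{u} R, Module.Flat R F → Ext1Vanishes F M

/-- A chain complex `F` of `R`-modules is an F-totally acyclic complex of flats if all its
components are flat, it is acyclic, and `I ⊗[R] F` is acyclic for every injective
`R`-module `I`. -/
def FTotallyAcyclic (F : ChainComplex (ModuleCat.{u} R) ℤ) : Prop :=
  (∀ n, Module.Flat R (F.X n)) ∧ (∀ n, F.ExactAt n) ∧
    ∀ I : ModuleCat.{u} R, Module.Injective R I →
      ∀ n, (((tensorLeft I).mapHomologicalComplex (ComplexShape.down ℤ)).obj F).ExactAt n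

/-- An `R`-module is Gorenstein flat if it is isomorphic to `Z₀ F` for some F-totally
acyclic complex of flats `F`. -/
def IsGorensteinFlat (G : ModuleCat.{u} R) : Prop :=
  ∃ F : ChainComplex (ModuleCat.{u} R) ℤ, FTotallyAcyclic F ∧ Nonempty (G ≅ F.cycles 0)

/-- An `R`-module `L` is Gorenstein cotorsion if `Ext¹_R(G, L) = 0` for every Gorenstein
flat `R`-module `G`. -/
def IsGorensteinCotorsion (L : ModuleCat.{u} R) : Prop :=
  ∀ G : ModuleCat.{u} R, IsGorensteinFlat G → Ext1Vanishes G L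

/-- If `Ext¹(A, B)` vanishes, every short exact sequence with ends isomorphic to `B` and `A`
splits. -/
lemma Ext1Vanishes.nonempty_splitting {C : Type*} [Category C] [Abelian C] {A B : C}
    (h : Ext1Vanishes A B) {S : ShortComplex C} (hS : S.ShortExact)
    (e₁ : S.X₁ ≅ B) (e₃ : S.X₃ ≅ A) : Nonempty S.Splitting := by
  have w : (e₁.inv ≫ S.f) ≫ S.g ≫ e₃.hom = 0 := by simp
  let e : S ≅ ShortComplex.mk (e₁.inv ≫ S.f) (S.g ≫ e₃.hom) w :=
    ShortComplex.isoMk e₁ (Iso.refl _) e₃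
  obtain ⟨s, hs⟩ := h _ _ _ w (ShortComplex.shortExact_of_iso e hS)
  refine ⟨ShortComplex.Splitting.ofExactOfSection S hS.exact (e₃.hom ≫ s) ?_ hS.mono_f⟩
  rw [← cancel_mono e₃.hom, Category.assoc, Category.assoc, hs]
  simp

lemma Ext1Vanishes.of_iso_left {C : Type*} [Category C] [Abelian C] {A A' B : C}
    (h : Ext1Vanishes A B) (e : A' ≅ A) : Ext1Vanishes A' B := by
  intro E f g w hS
  obtain ⟨σ⟩ := h.nonempty_splitting hS (Iso.refl _) e
  exact ⟨σ.s, σ.s_g⟩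

/-- If `Ext¹(A, S.X₁)` vanishes, every morphism `A ⟶ S.X₃` lifts along `S.g`. -/
lemma Ext1Vanishes.exists_lift {C : Type*} [Category C] [Abelian C]
    {S : ShortComplex C} (hS : S.ShortExact) {A : C} (h : Ext1Vanishes A S.X₁)
    (φ : A ⟶ S.X₃) : ∃ l : A ⟶ S.X₂, l ≫ S.g = φ := by
  have := hS.epi_g
  have := hS.mono_f
  have w : pullback.lift S.f (0 : S.X₁ ⟶ A) (by simp) ≫ pullback.snd S.g φ = 0 :=
    pullback.lift_snd _ _ _
  have hmono : Mono (pullback.lift S.f (0 : S.X₁ ⟶ A) (by simp : S.f ≫ S.g = 0 ≫ φ)) :=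
    mono_of_mono_fac (pullback.lift_fst _ _ _)
  have hex : (ShortComplex.mk _ _ w).Exact := by
    refine ShortComplex.exact_of_f_is_kernel _ (KernelFork.IsLimit.ofι' _ _ fun k hk => ?_)
    have hk' : (k ≫ pullback.fst S.g φ) ≫ S.g = 0 := by
      rw [Category.assoc, pullback.condition, reassoc_of% hk, zero_comp]
    refine ⟨hS.exact.lift _ hk', pullback.hom_ext ?_ ?_⟩
    · rw [Category.assoc, pullback.lift_fst, hS.exact.lift_f]
    · rw [Category.assoc, pullback.lift_snd, comp_zero, ← hk]
  obtain ⟨s, hs⟩ := h _ _ _ w { exact := hex, mono_f := hmono, epi_g := by dsimp; infer_instance }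
  exact ⟨s ≫ pullback.fst _ _, by rw [Category.assoc, pullback.condition, reassoc_of% hs]⟩

namespace HomologicalComplex

variable {C ι : Type*} [Category C] [Abelian C] {c : ComplexShape ι}

/-- If `0 ⟶ K₁ ⟶ K₂ ⟶ K₃ ⟶ 0` is a short exact sequence of complexes, `K₃` is exact in degree
`i` and the differential of `K₁` out of degree `j` vanishes, then the sequence of opcycles in
degree `j` is short exact. -/
lemma opcycles_shortExact {S : ShortComplex (HomologicalComplex C c)} (hS : S.ShortExact)
    {i j : ι} (hij : c.Rel i j) (hi : S.X₃.ExactAt i) (hj : ∀ k, S.X₁.d j k = 0) :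
    (ShortComplex.mk (opcyclesMap S.f j) (opcyclesMap S.g j)
      (by rw [← opcyclesMap_comp, S.zero, opcyclesMap_zero])).ShortExact := by
  have := hS.epi_g
  have : IsIso (S.X₁.homologyι j) := S.X₁.isIso_homologyι j _ rfl (hj _)
  have : Mono (homologyMap S.f j) :=
    (hS.homology_exact₁ i j hij).mono_g
      (((exactAt_iff_isZero_homology _ _).1 hi).eq_of_src _ _)
  have hmono : Mono (S.X₁.homologyι j ≫ opcyclesMap S.f j) := by
    rw [← homologyι_naturality]
    infer_instance
  exact
    { exact := opcycles_right_exact S hS.exact j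
      mono_f := (MorphismProperty.cancel_left_of_respectsIso (.monomorphisms C) _ _).1 hmono
      epi_g := by dsimp; infer_instance }

/-- If `K` is exact in some degree `i` mapping to `j`, then `Ext¹(K, Sʲ(L))` vanishes if and
only if `Ext¹(Kⱼ/Bⱼ(K), L)` does. -/
lemma ext1Vanishes_single_iff [DecidableEq ι] (K : HomologicalComplex C c) {i j : ι} (hij : c.Rel i j)
    (hi : K.ExactAt i) (L : C) :
    Ext1Vanishes K ((single C c j).obj L) ↔ Ext1Vanishes (K.opcycles j) L := by
  constructor
  · intro h E f g w hS
    obtain ⟨l, hl⟩ : ∃ l : K ⟶ (single C c j).obj E, l ≫ (single C c j).map g =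
        mkHomToSingle (K.pOpcycles j) (fun k _ => K.d_pOpcycles k j) :=
      Ext1Vanishes.exists_lift (hS.map_of_exact (single C c j)) h _
    refine ⟨K.descOpcycles (l.f j ≫ (singleObjXSelf c j E).hom) _ rfl ?_, ?_⟩
    · rw [← l.comm_assoc, single_obj_d, zero_comp, comp_zero]
    · have := congr_arg (fun q => q.f j) hl
      simp only [comp_f, single_map_f_self, mkHomToSingle_f, ← Category.assoc, cancel_mono] at this
      simpa [← cancel_epi (K.pOpcycles j)] using this
  · intro h E f g w hS
    obtain ⟨σ⟩ := h.nonempty_splitting (opcycles_shortExact hS hij hi (fun k => by simp))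
      (singleObjOpcyclesSelfIso c j L).symm (Iso.refl _)
    let r : E ⟶ (single C c j).obj L :=
      mkHomToSingle (E.pOpcycles j ≫ σ.r ≫ (singleObjOpcyclesSelfIso c j L).inv) (by simp)
    have hr : f ≫ r = 𝟙 _ := by
      apply from_single_hom_ext
      have := σ.f_r
      dsimp at this
      simp [r, ← p_opcyclesMap_assoc, reassoc_of% this]
    exact ⟨_, (ShortComplex.Splitting.ofExactOfRetraction _ hS.exact r hr hS.epi_g).s_g⟩

/-- In a complex which is exact in degrees `i` and `j`, the map `Kᵢ/Bᵢ(K) ⟶ Zⱼ(K)` induced by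
the differential is an isomorphism. -/
lemma isIso_opcyclesToCycles (K : HomologicalComplex C c) {i j : ι} (hij : c.Rel i j)
    (hi : K.ExactAt i) (hj : K.ExactAt j) : IsIso (K.opcyclesToCycles i j) := by
  have h := HomologySequence.composableArrows₃_exact K i j hij
  have : Mono (K.opcyclesToCycles i j) :=
    (h.exact 0).mono_g (((exactAt_iff_isZero_homology _ _).1 hi).eq_of_src _ _)
  have : Epi (K.opcyclesToCycles i j) :=
    (h.exact 1).epi_f (((exactAt_iff_isZero_homology _ _).1 hj).eq_of_tgt _ _)
  exact isIso_of_mono_of_epi _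

end HomologicalComplex

/-- The complex `K` reindexed by `n ↦ n + k`, with the same differentials. -/
def ChainComplex.translate {C : Type*} [Category C] [HasZeroMorphisms C]
    (K : ChainComplex C ℤ) (k : ℤ) : ChainComplex C ℤ where
  X n := K.X (n + k)
  d i j := K.d (i + k) (j + k)
  shape i j hij := K.shape _ _ fun h => hij (by simp only [ComplexShape.down_Rel] at h ⊢; omega)

lemma ChainComplex.translate_exactAt {C : Type*} [Category C] [Abelian C]
    {K : ChainComplex C ℤ} (k : ℤ) {n : ℤ} (h : K.ExactAt (n + k)) :
    (K.translate k).ExactAt n := by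
  rw [HomologicalComplex.exactAt_iff' _ (n + 1) n (n - 1) (by simp) (by simp)]
  exact (K.exactAt_iff' (n + 1 + k) (n + k) (n - 1 + k) (by simp; omega) (by simp; omega)).1 h

/-- The cycles of a translated complex. -/
noncomputable def ChainComplex.translateCyclesIso {C : Type*} [Category C] [Abelian C]
    (K : ChainComplex C ℤ) (k n : ℤ) :
    (K.translate k).cycles n ≅ K.cycles (n + k) :=
  (K.translate k).cyclesIsoSc' (n + 1) n (n - 1) (by simp) (by simp) ≪≫
    (K.cyclesIsoSc' (n + 1 + k) (n + k) (n - 1 + k) (by simp; omega) (by simp; omega)).symm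

lemma FTotallyAcyclic.translate {F : ChainComplex (ModuleCat.{u} R) ℤ} (hF : FTotallyAcyclic F)
    (k : ℤ) : FTotallyAcyclic (F.translate k) :=
  ⟨fun _ => hF.1 _, fun _ => ChainComplex.translate_exactAt k (hF.2.1 _),
    fun I hI _ => ChainComplex.translate_exactAt
      (K := ((tensorLeft I).mapHomologicalComplex (ComplexShape.down ℤ)).obj F) k (hF.2.2 I hI _)⟩

/-- The cycles of an F-totally acyclic complex of flats are Gorenstein flat in every degree. -/
lemma FTotallyAcyclic.isGorensteinFlat_cycles {F : ChainComplex (ModuleCat.{u} R) ℤ}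
    (hF : FTotallyAcyclic F) (n : ℤ) : IsGorensteinFlat (F.cycles n) :=
  ⟨F.translate n, hF.translate n,
    ⟨eqToIso (by rw [zero_add]) ≪≫ (F.translateCyclesIso n 0).symm⟩⟩

/-- The opcycles `Fᵢ/Bᵢ(F)` of an F-totally acyclic complex of flats are the cycles in the next
degree. -/
noncomputable def FTotallyAcyclic.opcyclesIsoCycles {F : ChainComplex (ModuleCat.{u} R) ℤ}
    (hF : FTotallyAcyclic F) {i j : ℤ} (hij : j + 1 = i) : F.opcycles i ≅ F.cycles j :=
  haveI := F.isIso_opcyclesToCycles (i := i) (j := j) hij (hF.2.1 i) (hF.2.1 j)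
  asIso (F.opcyclesToCycles i j)

theorem ext1_sphere_vanishes_iff_gorensteinCotorsion
    [IsNoetherianRing R] (L : ModuleCat.{u} R) :
    (∀ F : ChainComplex (ModuleCat.{u} R) ℤ, FTotallyAcyclic F →
        Ext1Vanishes F
          ((HomologicalComplex.single (ModuleCat.{u} R) (ComplexShape.down ℤ) 0).obj L)) ↔
      IsGorensteinCotorsion L := by
  have key : ∀ F : ChainComplex (ModuleCat.{u} R) ℤ, FTotallyAcyclic F →
      (Ext1Vanishes F
        ((HomologicalComplex.single (ModuleCat.{u} R) (ComplexShape.down ℤ) 0).obj L) ↔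
        Ext1Vanishes (F.opcycles 0) L) := fun F hF =>
    F.ext1Vanishes_single_iff (i := 1) (j := 0) (by simp) (hF.2.1 1) L
  constructor
  · rintro h G ⟨F, hF, ⟨e⟩⟩
    have hF' := hF.translate 1
    refine ((key _ hF').1 (h _ hF')).of_iso_left
      (e ≪≫ ?_ ≪≫ (hF'.opcyclesIsoCycles (j := -1) (by simp)).symm)
    exact (F.translateCyclesIso 1 (-1)).symm
  · intro h F hF
    exact (key F hF).2 ((h _ (hF.isGorensteinFlat_cycles (-1))).of_iso_left
      (hF.opcyclesIsoCycles (by simp)))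
end

section
/- Let R be a commutative Noetherian ring and C a cotorsion R-module. Suppose 0 → Y → F → S^0(C) → 0 is a short exact sequence in the abelian category Ch(R) of chain complexes of R-modules, where F is an F-totally acyclic complex of flats and where Ext^1(F', Y) = 0 (computed in Ch(R)) for every F-totally acyclic complex of flats F'. Then the R-module Y_0 / B_0(Y), i.e. the cokernel of the differential d_1 : Y_1 → Y_0, is Gorenstein cotorsion. -/
/-!
STATEMENT 11: Let `R` be a commutative Noetherian ring and `C` a cotorsion `R`-module.
Suppose `0 → Y → F → S⁰ C → 0` is a short exact sequence in `Ch(R)` with `F` an F-totally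
acyclic complex of flats and `Ext¹(F', Y) = 0` for every F-totally acyclic complex of
flats `F'`.  Then `Y₀ / B₀ Y = coker (d₁ : Y₁ → Y₀)` is Gorenstein cotorsion.

The vanishing of the (Yoneda) group `Ext¹(A, B)` is expressed by the (equivalent)
statement that every short exact sequence `0 → B → E → A → 0` splits.
-/

universe u

open CategoryTheory MonoidalCategory Limits

variable {R : Type u} [CommRing R]

section CharacterModules

/-- The canonical map from a module to its double character module. -/
def characterEval (M : Type u) [AddCommGroup M] [Module R M] :
    M →ₗ[R] CharacterModule (CharacterModule M) where
  toFun x := AddMonoidHom.mk' (fun c : CharacterModule M => c x) fun _ _ => rfl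
  map_add' x y := CharacterModule.ext _ fun c => c.map_add x y
  map_smul' _ _ := rfl

lemma characterEval_injective (M : Type u) [AddCommGroup M] [Module R M] :
    Function.Injective (characterEval (R := R) M) :=
  (injective_iff_map_eq_zero _).2 fun _ h =>
    CharacterModule.eq_zero_of_character_apply fun c => congr($h c)

lemma exists_eq_smul_of_injective (M : Type u) [AddCommGroup M] [Module R M] [Module.Injective R M]
    {l : ℕ} (f : Fin l → R) (m : Fin l → M)
    (h : ∀ a : Fin l → R, ∑ i, f i * a i = 0 → ∑ i, a i • m i = 0) :
    ∃ x : M, ∀ i, m i = f i • x := by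
  let φ : (Fin l → R) →ₗ[R] R := Fintype.linearCombination R f
  let g : (Fin l → R) →ₗ[R] M := Fintype.linearCombination R m
  have hφg : LinearMap.ker φ ≤ LinearMap.ker g := fun a ha => by
    simp only [LinearMap.mem_ker, φ, g, Fintype.linearCombination_apply, smul_eq_mul] at ha ⊢
    exact h a (by simpa [mul_comm] using ha)
  obtain ⟨e, he⟩ := Module.Injective.extension_property R _ _ _
    ((LinearMap.ker φ).liftQ φ le_rfl)
    (LinearMap.ker_eq_bot.1 (Submodule.ker_liftQ_eq_bot _ _ _ le_rfl))
    ((LinearMap.ker φ).liftQ g hφg)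
  refine ⟨e 1, fun i => ?_⟩
  have := congr($he (Submodule.Quotient.mk (Pi.single i 1)))
  simp only [LinearMap.comp_apply, Submodule.liftQ_apply] at this
  rw [← map_smul, smul_eq_mul, mul_one]
  simpa [φ, g] using this.symm

lemma flat_characterModule_of_injective [IsNoetherianRing R] (M : Type u) [AddCommGroup M]
    [Module R M] [Module.Injective R M] : Module.Flat R (CharacterModule M) := by
  refine Module.Flat.of_forall_isTrivialRelation fun {l f x} hfx => ?_
  obtain ⟨k, a, ha⟩ := Submodule.fg_iff_exists_fin_generating_family.1
    (IsNoetherian.noetherian (LinearMap.ker (Fintype.linearCombination R f)))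
  have ha_ker : ∀ j, ∑ i, f i * a j i = 0 := fun j => by
    have : a j ∈ LinearMap.ker (Fintype.linearCombination R f) :=
      ha ▸ Submodule.subset_span ⟨j, rfl⟩
    simpa [Fintype.linearCombination_apply, mul_comm] using this
  let A : (Fin l → M) →ₗ[R] (Fin k → M) :=
    LinearMap.pi fun j => ∑ i, a j i • LinearMap.proj i
  have hA : ∀ m j, A m j = ∑ i, a j i • m i := fun m j => by simp [A]
  let X : (Fin l → M) →+ AddCircle (1 : ℚ) :=
    ∑ i, (x i : M →+ AddCircle (1 : ℚ)).comp (Pi.evalAddMonoidHom _ i)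
  have hX : ∀ m, X m = ∑ i, x i (m i) := fun m => by
    simp only [X, AddMonoidHom.finsetSum_apply]; rfl
  have hker : ∀ m, A m = 0 → X m = 0 := fun m hm => by
    obtain ⟨y, hy⟩ := exists_eq_smul_of_injective M f m fun b hb => by
      have hb : b ∈ LinearMap.ker (Fintype.linearCombination R f) := by
        simpa [Fintype.linearCombination_apply, mul_comm] using hb
      rw [← ha] at hb
      have : Submodule.span R (Set.range a) ≤
          LinearMap.ker (Fintype.linearCombination R m) := by
        rw [Submodule.span_le]
        rintro _ ⟨j, rfl⟩
        simpa [Fintype.linearCombination_apply, hA] using congr_fun hm j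
      simpa [Fintype.linearCombination_apply] using this hb
    rw [hX]
    simp only [hy]
    have h0 : CharacterModule.dual (R := R) .id (∑ i, f i • x i) y = 0 := by
      rw [hfx, map_zero]; rfl
    rw [map_sum] at h0
    exact (AddMonoidHom.finsetSum_apply _ _ _).symm.trans h0
  obtain ⟨Y, hY⟩ := CharacterModule.dual_surjective_of_injective
    ((LinearMap.ker A).liftQ A le_rfl)
    (LinearMap.ker_eq_bot.1 (Submodule.ker_liftQ_eq_bot _ _ _ le_rfl))
    (QuotientAddGroup.lift (LinearMap.ker A).toAddSubgroup X fun m hm => hker m hm)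
  have hYA : ∀ m, Y (A m) = X m := fun m => congr($hY (Submodule.Quotient.mk m))
  refine ⟨k, fun i j => a j i, fun j => Y.comp (AddMonoidHom.single (fun _ : Fin k => M) j),
    fun i => CharacterModule.ext _ fun m => ?_, ha_ker⟩
  have h1 : X (Pi.single i m) = x i m := by
    rw [hX, Finset.sum_eq_single i]
    · simp
    · intro b _ hb; simp [Pi.single_eq_of_ne hb]
    · simp
  have h2 : A (Pi.single i m) = ∑ j, Pi.single j (a j i • m) := by
    ext j
    rw [hA, Finset.sum_apply, Finset.sum_eq_single i, Finset.sum_eq_single j]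
    · simp
    · intro b _ hb; simp [Pi.single_eq_of_ne hb.symm]
    · simp
    · intro b _ hb; simp [Pi.single_eq_of_ne hb]
    · simp
  rw [← h1, ← hYA, h2, map_sum]
  symm
  refine (AddMonoidHom.finsetSum_apply _ _ _).trans ?_
  rfl

/-- A flat cotorsion module over a Noetherian ring is a retract of its double character module. -/
lemma exists_retraction_characterEval [IsNoetherianRing R] (D : ModuleCat.{u} R)
    (hflat : Module.Flat R D) (hcot : IsCotorsionModule D) :
    ∃ r : CharacterModule (CharacterModule D) →ₗ[R] D, r ∘ₗ characterEval (R := R) D = .id := by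
  have : Module.Injective R (CharacterModule D) :=
    Module.Flat.iff_characterModule_injective.1 hflat
  have := flat_characterModule_of_injective (R := R) (CharacterModule D)
  have hinj := Module.Flat.iff_characterModule_injective.1 this
  let ev := characterEval (R := R) D
  let Q := CharacterModule (CharacterModule D) ⧸ LinearMap.range ev
  have hQ : Module.Flat R Q := by
    rw [Module.Flat.iff_characterModule_injective]
    let q := CharacterModule.dual (LinearMap.range ev).mkQ
    have hq : Function.Injective q :=
      CharacterModule.dual_injective_of_surjective _ (Submodule.mkQ_surjective _)
    let s := characterEval (R := R) (CharacterModule D)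
    let p : CharacterModule (CharacterModule (CharacterModule D)) →ₗ[R]
        CharacterModule (CharacterModule (CharacterModule D)) :=
      .id - s ∘ₗ CharacterModule.dual ev
    have hp : ∀ c, p c ∈ LinearMap.range q := fun c => by
      refine ⟨QuotientAddGroup.lift (LinearMap.range ev).toAddSubgroup (p c) ?_, rfl⟩
      rintro _ ⟨x, rfl⟩
      change c (ev x) - ev x (CharacterModule.dual ev c) = 0
      exact sub_self _
    have hpq : ∀ c, p (q c) = q c := fun c => by
      have : CharacterModule.dual ev (q c) = 0 := CharacterModule.ext _ fun x => by
        change c (Submodule.Quotient.mk (ev x)) = 0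
        rw [(Submodule.Quotient.mk_eq_zero (LinearMap.range ev)).2 ⟨x, rfl⟩, map_zero]
      simp [p, this]
    constructor
    intro X Y _ _ _ _ f hf g
    obtain ⟨h, hh⟩ := hinj.out f hf (q ∘ₗ g)
    refine ⟨(LinearEquiv.ofInjective q hq).symm ∘ₗ (p ∘ₗ h).codRestrict _ fun y => hp (h y),
      fun x => ?_⟩
    apply hq
    simp only [LinearMap.comp_apply]
    have h1 : ∀ z, q ((LinearEquiv.ofInjective q hq).symm z) = z := fun z =>
      congrArg Subtype.val ((LinearEquiv.ofInjective q hq).apply_symm_apply z)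
    erw [h1]
    change p (h (f x)) = _
    rw [hh]
    exact hpq _
  have hS : (ShortComplex.mk (ModuleCat.ofHom ev) (ModuleCat.ofHom (LinearMap.range ev).mkQ)
      (by ext x; exact (Submodule.Quotient.mk_eq_zero _).2 ⟨x, rfl⟩)).ShortExact :=
    ModuleCat.shortComplex_shortExact _
      (LinearMap.exact_iff.2 (Submodule.ker_mkQ _))
      (characterEval_injective (R := R) D) (Submodule.mkQ_surjective _)
  obtain ⟨s, hs⟩ := hcot (ModuleCat.of R Q) hQ _ _ _ _ hS
  let σ := ShortComplex.Splitting.ofExactOfSection _ hS.exact s hs hS.mono_f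
  exact ⟨σ.r.hom, by simpa using congr(($σ.f_r).hom)⟩

/-- Maps into flat cotorsion modules extend along maps that stay injective after tensoring with
injective modules. -/
lemma exists_extension_of_lTensor_injective [IsNoetherianRing R] {K A D : ModuleCat.{u} R}
    (ι : K ⟶ A)
    (hι : ∀ I : ModuleCat.{u} R, Module.Injective R I → Function.Injective (ι.hom.lTensor I))
    (hflat : Module.Flat R D) (hcot : IsCotorsionModule D) (f : K ⟶ D) :
    ∃ g : A ⟶ D, ι ≫ g = f := by
  obtain ⟨r, hr⟩ := exists_retraction_characterEval D hflat hcot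
  have h1 := hι (ModuleCat.of R (CharacterModule D))
    (Module.Flat.iff_characterModule_injective.1 hflat)
  rw [LinearMap.lTensor_inj_iff_rTensor_inj, rTensor_injective_iff_lcomp_surjective] at h1
  obtain ⟨g, hg⟩ := h1 (characterEval (R := R) D ∘ₗ f.hom)
  refine ⟨ModuleCat.ofHom (r ∘ₗ g), ?_⟩
  ext x
  have h2 := congr(r ($hg x))
  have h3 := congr($hr (f.hom x))
  exact h2.trans h3

end CharacterModules

section IntFamilies

/-- Construct a `ℤ`-indexed family with prescribed relations between neighbours by extending a
starting value in both directions. -/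
lemma exists_int_family {α : ℤ → Type*} (Q : ∀ i j, α i → α j → Prop) (good : ∀ n, α n → Prop)
    (a₀ : α 0) (h₀ : good 0 a₀)
    (up : ∀ i j, i + 1 = j → 0 ≤ i → ∀ a, good i a → ∃ b, good j b ∧ Q i j a b)
    (down : ∀ i j, i + 1 = j → j ≤ 0 → ∀ b, good j b → ∃ a, good i a ∧ Q i j a b) :
    ∃ f : ∀ n, α n, f 0 = a₀ ∧ ∀ i j, i + 1 = j → Q i j (f i) (f j) := by
  choose u hu using fun (n : ℕ) (a : {a : α n // good n a}) =>
    up n (n + 1 : ℕ) (by simp) (by simp) a.1 a.2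
  choose v hv using fun (n : ℕ) (b : {b : α (-n) // good (-n) b}) =>
    down (-(n + 1 : ℕ)) (-n) (by simp) (by simp) b.1 b.2
  let U : ∀ n : ℕ, {a : α n // good n a} := fun n =>
    Nat.rec ⟨a₀, h₀⟩ (fun n a => ⟨u n a, (hu n a).1⟩) n
  let V : ∀ n : ℕ, {a : α (-n) // good (-n) a} := fun n =>
    Nat.rec ⟨a₀, h₀⟩ (fun n a => ⟨v n a, (hv n a).1⟩) n
  refine ⟨fun n => match n with
    | .ofNat n => (U n).1
    | .negSucc n => (V (n + 1)).1, rfl, ?_⟩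
  rintro i j rfl
  match i with
  | .ofNat n => exact (hu n (U n)).2
  | .negSucc 0 => exact (hv 0 (V 0)).2
  | .negSucc (n + 1) => exact (hv (n + 1) (V (n + 1))).2

end IntFamilies

section ExtVanishing

open Abelian

lemma subsingleton_ext_succ_of_shortExact {S : ShortComplex (ModuleCat.{u} R)} (hS : S.ShortExact)
    (N : ModuleCat.{u} R) (k : ℕ) (h₁ : Subsingleton (Ext S.X₁ N k))
    (h₂ : Subsingleton (Ext S.X₂ N (k + 1))) : Subsingleton (Ext S.X₃ N (k + 1)) := by
  refine subsingleton_of_forall_eq 0 fun x => ?_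
  obtain ⟨y, rfl⟩ := Ext.contravariant_sequence_exact₃ hS N x (Subsingleton.elim _ _)
    (add_comm 1 k)
  rw [Subsingleton.elim y 0, Ext.comp_zero]

lemma subsingleton_ext_of_shortExact {S : ShortComplex (ModuleCat.{u} R)} (hS : S.ShortExact)
    (N : ModuleCat.{u} R) (k : ℕ) (h₂ : Subsingleton (Ext S.X₂ N k))
    (h₃ : Subsingleton (Ext S.X₃ N (k + 1))) : Subsingleton (Ext S.X₁ N k) := by
  refine subsingleton_of_forall_eq 0 fun x => ?_
  obtain ⟨y, rfl⟩ := Ext.contravariant_sequence_exact₁ hS N x (add_comm 1 k)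
    (Subsingleton.elim _ _)
  rw [Subsingleton.elim y 0, Ext.comp_zero]

lemma subsingleton_ext_one_of_extension {S : ShortComplex (ModuleCat.{u} R)} (hS : S.ShortExact)
    (N : ModuleCat.{u} R) (h₂ : Subsingleton (Ext S.X₂ N 1))
    (h : ∀ f : S.X₁ ⟶ N, ∃ g : S.X₂ ⟶ N, S.f ≫ g = f) : Subsingleton (Ext S.X₃ N 1) := by
  refine subsingleton_of_forall_eq 0 fun x => ?_
  obtain ⟨y, rfl⟩ := Ext.contravariant_sequence_exact₃ hS N x (Subsingleton.elim _ _)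
    (add_zero 1)
  obtain ⟨f, rfl⟩ := (Ext.mk₀_bijective _ _).2 y
  obtain ⟨g, rfl⟩ := h f
  rw [← Ext.mk₀_comp_mk₀, ← Ext.comp_assoc _ _ _ (add_zero 1) (zero_add 0) (by lia),
    hS.extClass_comp, Ext.zero_comp]

lemma exists_extension_of_subsingleton_ext {S : ShortComplex (ModuleCat.{u} R)}
    (hS : S.ShortExact) (N : ModuleCat.{u} R) (h₃ : Subsingleton (Ext S.X₃ N 1))
    (f : S.X₁ ⟶ N) : ∃ g : S.X₂ ⟶ N, S.f ≫ g = f := by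
  obtain ⟨y, hy⟩ := Ext.contravariant_sequence_exact₁ hS N (Ext.mk₀ f) (add_zero 1)
    (Subsingleton.elim _ _)
  obtain ⟨g, rfl⟩ := (Ext.mk₀_bijective _ _).2 y
  exact ⟨g, (Ext.mk₀_bijective _ _).1 (by rw [← hy, Ext.mk₀_comp_mk₀])⟩

/-- Vanishing of all positive `Ext` groups into the character module of `I`, equivalently of all
positive `Tor` groups against `I`. -/
def ExtCharacterVanishes (M I : ModuleCat.{u} R) : Prop :=
  ∀ k, Subsingleton (Ext M (ModuleCat.of R (CharacterModule I)) (k + 1))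

lemma lTensor_injective_iff_extension {K A : ModuleCat.{u} R} (ι : K ⟶ A) (I : ModuleCat.{u} R) :
    Function.Injective (ι.hom.lTensor I) ↔
      ∀ f : K ⟶ ModuleCat.of R (CharacterModule I), ∃ g, ι ≫ g = f := by
  rw [LinearMap.lTensor_inj_iff_rTensor_inj, rTensor_injective_iff_lcomp_surjective]
  refine ⟨fun h f => ?_, fun h f => ?_⟩
  · obtain ⟨g, hg⟩ := h f.hom
    exact ⟨ModuleCat.ofHom g, ModuleCat.hom_ext hg⟩
  · obtain ⟨g, hg⟩ := h (ModuleCat.ofHom f)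
    exact ⟨g.hom, congr(($hg).hom)⟩

lemma exists_projective_cover (M : ModuleCat.{u} R) :
    ∃ S : ShortComplex (ModuleCat.{u} R), S.ShortExact ∧ S.X₃ = M ∧ Projective S.X₂ :=
  ⟨ShortComplex.mk _ _ (kernel.condition (Projective.π M)),
    { exact := ShortComplex.exact_of_f_is_kernel _ (kernelIsKernel _) }, rfl,
    inferInstanceAs (Projective (Projective.over M))⟩

lemma flat_of_projective (P : ModuleCat.{u} R) [Projective P] : Module.Flat R P :=
  have : Module.Projective R P := (IsProjective.iff_projective P).2 inferInstance
  inferInstance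

lemma flat_of_shortExact {S : ShortComplex (ModuleCat.{u} R)} (hS : S.ShortExact)
    (h₂ : Module.Flat R S.X₂) (h₃ : Module.Flat R S.X₃) : Module.Flat R S.X₁ := by
  rw [Module.Flat.iff_rTensor_preserves_injective_linearMap]
  intro N N' _ _ _ _ f hf
  have hinj := LinearMap.lTensor_injective_of_exact_of_flat S.g.hom hS.moduleCat_surjective_g _
    hS.moduleCat_injective_f
    ((ShortComplex.ShortExact.moduleCat_exact_iff_function_exact S).1 hS.exact)
  have h := (Module.Flat.rTensor_preserves_injective_linearMap (M := S.X₂) f hf).comp (hinj N)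
  rw [← LinearMap.coe_comp, LinearMap.rTensor_comp_lTensor, ← LinearMap.lTensor_comp_rTensor,
    LinearMap.coe_comp] at h
  exact h.of_comp

lemma extCharacterVanishes_of_flat (A I : ModuleCat.{u} R) (hA : Module.Flat R A) :
    ExtCharacterVanishes A I := by
  intro k
  induction k generalizing A with
  | zero =>
    obtain ⟨S, hS, rfl, _⟩ := exists_projective_cover A
    refine subsingleton_ext_one_of_extension hS _ (Ext.subsingleton_of_projective _ _ 0)
      ((lTensor_injective_iff_extension _ _).1 ?_)
    exact LinearMap.lTensor_injective_of_exact_of_flat S.g.hom hS.moduleCat_surjective_g _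
      hS.moduleCat_injective_f
      ((ShortComplex.ShortExact.moduleCat_exact_iff_function_exact S).1 hS.exact) _
  | succ k ih =>
    obtain ⟨S, hS, rfl, _⟩ := exists_projective_cover A
    exact subsingleton_ext_succ_of_shortExact hS _ _
      (ih _ (flat_of_shortExact hS (flat_of_projective _) hA))
      (Ext.subsingleton_of_projective _ _ _)

end ExtVanishing

section SplicedComplexes

lemma function_exact_comp_comp {A B C D F : ModuleCat.{u} R} (p : A ⟶ B) (i : B ⟶ C) (q : C ⟶ D)
    (j : D ⟶ F) (hp : Function.Surjective p) (h : Function.Exact i q) (hj : Function.Injective j)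
    (f : A ⟶ C) (g : C ⟶ F) (hf : f = p ≫ i) (hg : g = q ≫ j) : Function.Exact f g := by
  subst hf hg
  intro c
  refine ⟨fun hc => ?_, ?_⟩
  · obtain ⟨b, rfl⟩ := (h c).1 (hj (by simpa using hc))
    obtain ⟨a, rfl⟩ := hp b
    exact ⟨a, rfl⟩
  · rintro ⟨a, rfl⟩
    have : q (i (p a)) = 0 := (h _).2 ⟨_, rfl⟩
    simp [this]

lemma exactAt_iff_function_exact (K : ChainComplex (ModuleCat.{u} R) ℤ) (n : ℤ) :
    K.ExactAt (n + 1) ↔ Function.Exact (K.d (n + 1 + 1) (n + 1)) (K.d (n + 1) n) := by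
  rw [HomologicalComplex.exactAt_iff' K (n + 1 + 1) (n + 1) n (by simp) (by simp),
    ShortComplex.ShortExact.moduleCat_exact_iff_function_exact]
  rfl

/-- A `ℤ`-indexed family of short exact sequences `0 → Z (n + 1) → X n → Z n → 0`. -/
structure SplicingData (R : Type u) [CommRing R] where
  /-- the modules at which the sequences are spliced -/
  Z : ℤ → ModuleCat.{u} R
  /-- the middle terms -/
  X : ℤ → ModuleCat.{u} R
  /-- the monomorphisms -/
  ι : ∀ n, Z (n + 1) ⟶ X n
  /-- the epimorphisms -/
  π : ∀ n, X n ⟶ Z n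
  w : ∀ n, ι n ≫ π n = 0
  shortExact : ∀ n, (ShortComplex.mk _ _ (w n)).ShortExact

namespace SplicingData

variable (E : SplicingData R)

/-- The acyclic complex obtained by splicing. -/
noncomputable abbrev complex : ChainComplex (ModuleCat.{u} R) ℤ :=
  ChainComplex.of E.X (fun n => E.π (n + 1) ≫ E.ι n)
    fun n => by rw [Category.assoc, reassoc_of% E.w (n + 1), zero_comp, comp_zero]

lemma complex_d (n : ℤ) : E.complex.d (n + 1) n = E.π (n + 1) ≫ E.ι n :=
  ChainComplex.of_d E.X (fun n => E.π (n + 1) ≫ E.ι n) _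

instance (n : ℤ) : Epi (E.π n) := (E.shortExact n).epi_g

instance (n : ℤ) : Mono (E.ι n) := (E.shortExact n).mono_f

lemma function_exact (n : ℤ) : Function.Exact (E.ι n) (E.π n) :=
  (ShortComplex.ShortExact.moduleCat_exact_iff_function_exact _).1 (E.shortExact n).exact

lemma π_surjective (n : ℤ) : Function.Surjective (E.π n) :=
  (E.shortExact n).moduleCat_surjective_g

lemma fTotallyAcyclic_complex (hflat : ∀ n, Module.Flat R (E.X n))
    (hE : ∀ n, ∀ I : ModuleCat.{u} R, Module.Injective R I →
      Function.Injective ((E.ι n).hom.lTensor I)) : FTotallyAcyclic E.complex := by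
  refine ⟨hflat, fun n => ?_, fun I hI n => ?_⟩
  · obtain ⟨n, rfl⟩ : ∃ m, n = m + 1 := ⟨n - 1, by simp⟩
    rw [exactAt_iff_function_exact]
    exact function_exact_comp_comp _ _ _ _ (E.π_surjective _) (E.function_exact _)
      (E.shortExact n).moduleCat_injective_f _ _ (E.complex_d _) (E.complex_d _)
  · obtain ⟨n, rfl⟩ : ∃ m, n = m + 1 := ⟨n - 1, by simp⟩
    rw [exactAt_iff_function_exact]
    refine function_exact_comp_comp (I ◁ E.π (n + 1 + 1)) (I ◁ E.ι (n + 1)) (I ◁ E.π (n + 1))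
      (I ◁ E.ι n)
      (LinearMap.lTensor_surjective _ (E.π_surjective _))
      (lTensor_exact _ (E.function_exact _) (E.π_surjective _)) (hE n I hI) _ _ ?_ ?_
    all_goals
      rw [← MonoidalCategory.whiskerLeft_comp, ← E.complex_d]
      rfl

end SplicingData

lemma iCycles_injective (F : ChainComplex (ModuleCat.{u} R) ℤ) (n : ℤ) :
    Function.Injective (F.iCycles n) :=
  (ModuleCat.mono_iff_injective _).1 inferInstance

lemma iCycles_toCycles_apply (F : ChainComplex (ModuleCat.{u} R) ℤ) (i j : ℤ) (x : F.X i) :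
    F.iCycles j (F.toCycles i j x) = F.d i j x :=
  ConcreteCategory.congr_hom (F.toCycles_i i j) x

lemma function_exact_iCycles_toCycles (F : ChainComplex (ModuleCat.{u} R) ℤ) (n : ℤ) :
    Function.Exact (F.iCycles (n + 1)) (F.toCycles (n + 1) n) := by
  have h := (ShortComplex.ShortExact.moduleCat_exact_iff_function_exact _).1
    (ShortComplex.exact_of_f_is_kernel
      (ShortComplex.mk (F.iCycles (n + 1)) (F.d (n + 1) n) (by simp))
      (F.cyclesIsKernel (n + 1) n (by simp)))
  intro x
  rw [← h x, ← map_eq_zero_iff (F.iCycles n).hom (iCycles_injective F n)]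
  exact iff_of_eq congr($(iCycles_toCycles_apply F (n + 1) n x) = 0)

lemma toCycles_surjective (F : ChainComplex (ModuleCat.{u} R) ℤ) {n : ℤ} (h : F.ExactAt n) :
    Function.Surjective (F.toCycles (n + 1) n) := by
  obtain ⟨n, rfl⟩ : ∃ m, n = m + 1 := ⟨n - 1, by simp⟩
  intro z
  have h1 : F.d (n + 1) n (F.iCycles (n + 1) z) = 0 :=
    ConcreteCategory.congr_hom (F.iCycles_d (n + 1) n) z
  obtain ⟨y, hy⟩ := ((exactAt_iff_function_exact _ _).1 h _).1 h1
  exact ⟨y, iCycles_injective F _ ((iCycles_toCycles_apply F _ _ y).trans hy)⟩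

lemma FTotallyAcyclic.lTensor_injective_iCycles {F : ChainComplex (ModuleCat.{u} R) ℤ}
    (hF : FTotallyAcyclic F) (n : ℤ) (I : ModuleCat.{u} R) (hI : Module.Injective R I) :
    Function.Injective ((F.iCycles (n + 1)).hom.lTensor I) := by
  have h : Function.Exact (I ◁ F.d (n + 1 + 1 + 1) (n + 1 + 1)) (I ◁ F.d (n + 1 + 1) (n + 1)) :=
    (exactAt_iff_function_exact _ _).1 (hF.2.2 I hI (n + 1 + 1))
  have hs : Function.Surjective (I ◁ F.toCycles (n + 1 + 1) (n + 1)) :=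
    LinearMap.lTensor_surjective _ (toCycles_surjective F (hF.2.1 _))
  refine (injective_iff_map_eq_zero (I ◁ F.iCycles (n + 1)).hom).2 fun x hx => ?_
  obtain ⟨y, rfl⟩ := hs x
  have h1 : (I ◁ F.d (n + 1 + 1) (n + 1)) y = 0 := by
    rw [← F.toCycles_i, MonoidalCategory.whiskerLeft_comp]
    exact hx
  obtain ⟨z, rfl⟩ := (h y).1 h1
  have h2 : I ◁ F.d (n + 1 + 1 + 1) (n + 1 + 1) ≫ I ◁ F.toCycles (n + 1 + 1) (n + 1) = 0 := by
    rw [← MonoidalCategory.whiskerLeft_comp, F.d_toCycles, MonoidalPreadditive.whiskerLeft_zero]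
  exact ConcreteCategory.congr_hom h2 z

/-- The family of short exact sequences `0 → Z (n + 1) → F (n + 1) → Z n → 0` of an
acyclic complex. -/
noncomputable def SplicingData.ofComplex (F : ChainComplex (ModuleCat.{u} R) ℤ)
    (hF : ∀ n, F.ExactAt n) : SplicingData R where
  Z n := F.cycles n
  X n := F.X (n + 1)
  ι n := F.iCycles (n + 1)
  π n := F.toCycles (n + 1) n
  w n := by ext x; exact (function_exact_iCycles_toCycles F n _).2 ⟨x, rfl⟩
  shortExact n := ModuleCat.shortComplex_shortExact _ (function_exact_iCycles_toCycles F n)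
    ((ModuleCat.mono_iff_injective _).1 inferInstance) (toCycles_surjective F (hF n))

end SplicedComplexes

section Resolutions

lemma FTotallyAcyclic.extCharacterVanishes_cycles {F : ChainComplex (ModuleCat.{u} R) ℤ}
    (hF : FTotallyAcyclic F) (n : ℤ) (I : ModuleCat.{u} R) (hI : Module.Injective R I) :
    ExtCharacterVanishes (F.cycles n) I := by
  intro k
  induction k generalizing n with
  | zero =>
    exact subsingleton_ext_one_of_extension ((SplicingData.ofComplex F hF.2.1).shortExact n) _
      (extCharacterVanishes_of_flat _ I (hF.1 (n + 1)) 0)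
      ((lTensor_injective_iff_extension _ _).1 (hF.lTensor_injective_iCycles n I hI))
  | succ k ih =>
    exact subsingleton_ext_succ_of_shortExact
      ((SplicingData.ofComplex F hF.2.1).shortExact n) _ _ (ih (n + 1))
      (extCharacterVanishes_of_flat _ I (hF.1 (n + 1)) _)

/-- The left half of an `F`-totally acyclic complex of flats can be replaced by a projective
resolution. -/
lemma FTotallyAcyclic.exists_splicingData {F : ChainComplex (ModuleCat.{u} R) ℤ}
    (hF : FTotallyAcyclic F) :
    ∃ E : SplicingData R, E.Z 0 = F.cycles 0 ∧ (∀ n, Module.Flat R (E.X n)) ∧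
      (∀ n, 0 ≤ n → Projective (E.X n)) ∧
      ∀ n, ∀ I : ModuleCat.{u} R, Module.Injective R I →
        Function.Injective ((E.ι n).hom.lTensor I) := by
  obtain ⟨Z, hZ, h⟩ := exists_int_family (α := fun _ => ModuleCat.{u} R)
    (fun i j A B => ∃ (X : ModuleCat.{u} R) (ι : B ⟶ X) (π : X ⟶ A) (w : ι ≫ π = 0),
      (ShortComplex.mk ι π w).ShortExact ∧ Module.Flat R X ∧ (0 ≤ i → Projective X) ∧
      ∀ I : ModuleCat.{u} R, Module.Injective R I → Function.Injective (ι.hom.lTensor I))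
    (fun n A => (∀ I : ModuleCat.{u} R, Module.Injective R I → ExtCharacterVanishes A I) ∧
      (n ≤ 0 → A = F.cycles n))
    (F.cycles 0) ⟨hF.extCharacterVanishes_cycles 0, fun _ => rfl⟩
    (by
      rintro i _ rfl hi A ⟨h, -⟩
      obtain ⟨S, hS, rfl, hP⟩ := exists_projective_cover A
      exact ⟨S.X₁, ⟨fun I hI k => subsingleton_ext_of_shortExact hS _ _
          (Abelian.Ext.subsingleton_of_projective _ _ k) (h I hI (k + 1)), by lia⟩,
        S.X₂, S.f, S.g, S.zero, hS, flat_of_projective _, fun _ => hP, fun I hI =>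
          (lTensor_injective_iff_extension _ _).2
            (exists_extension_of_subsingleton_ext hS _ (h I hI 0))⟩)
    (by
      rintro i _ rfl hi A ⟨-, h⟩
      obtain rfl := h hi
      let D := SplicingData.ofComplex F hF.2.1
      exact ⟨F.cycles i, ⟨hF.extCharacterVanishes_cycles i, fun _ => rfl⟩, F.X (i + 1), D.ι i,
        D.π i, D.w i, D.shortExact i, hF.1 _, by lia, hF.lTensor_injective_iCycles i⟩)
  choose X ι π w hS hX hP hI using fun n => h n (n + 1) rfl
  exact ⟨⟨Z, X, ι, π, w, hS⟩, hZ, hX, hP, hI⟩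

end Resolutions

section YonedaVanishing

variable {𝒞 : Type*} [Category 𝒞] [Abelian 𝒞]

lemma Ext1Vanishes.exists_retraction {S : ShortComplex 𝒞} (h : Ext1Vanishes S.X₃ S.X₁)
    (hS : S.ShortExact) : ∃ r : S.X₂ ⟶ S.X₁, S.f ≫ r = 𝟙 S.X₁ := by
  obtain ⟨s, hs⟩ := h _ _ _ _ hS
  exact ⟨_, (ShortComplex.Splitting.ofExactOfSection _ hS.exact s hs hS.mono_f).f_r⟩

lemma Ext1Vanishes.exists_extension {S : ShortComplex 𝒞} {B : 𝒞} (h : Ext1Vanishes S.X₃ B)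
    (hS : S.ShortExact) (f : S.X₁ ⟶ B) : ∃ g : S.X₂ ⟶ B, S.f ≫ g = f := by
  have := hS.mono_f
  have := hS.epi_g
  have w : S.f ≫ S.g = f ≫ (0 : B ⟶ S.X₃) := by rw [S.zero, comp_zero]
  let T : ShortComplex 𝒞 := ShortComplex.mk (pushout.inr S.f f) (pushout.desc S.g 0 w)
    (pushout.inr_desc _ _ _)
  have hg : Epi T.g := epi_of_epi_fac (pushout.inl_desc S.g 0 w)
  have hT : T.ShortExact :=
    { exact := by
        refine ShortComplex.exact_of_g_is_cokernel _
          (CokernelCofork.IsColimit.ofπ' _ _ fun k hk => ?_)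
        have hk' : S.f ≫ pushout.inl S.f f ≫ k = 0 := by
          rw [pushout.condition_assoc]
          exact (f ≫= hk).trans comp_zero
        refine ⟨hS.exact.desc _ hk', pushout.hom_ext ?_ ?_⟩
        · rw [pushout.inl_desc_assoc, hS.exact.g_desc]
        · rw [pushout.inr_desc_assoc, zero_comp]
          exact hk.symm
      mono_f := Abelian.mono_pushout_of_mono_f _ _
      epi_g := hg }
  obtain ⟨r, hr⟩ := Ext1Vanishes.exists_retraction (S := T) h hT
  exact ⟨pushout.inl _ _ ≫ r, by
    rw [pushout.condition_assoc]
    exact (f ≫= hr).trans (Category.comp_id f)⟩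

lemma Ext1Vanishes.of_exists_retraction {A B : 𝒞}
    (h : ∀ (E : 𝒞) (f : B ⟶ E) (g : E ⟶ A) (w : f ≫ g = 0), (ShortComplex.mk f g w).ShortExact →
      ∃ r : E ⟶ B, f ≫ r = 𝟙 B) : Ext1Vanishes A B := by
  intro E f g w hS
  obtain ⟨r, hr⟩ := h E f g w hS
  exact ⟨_, (ShortComplex.Splitting.ofExactOfRetraction _ hS.exact r hr hS.epi_g).s_g⟩

lemma Ext1Vanishes.of_iso {A A' B : 𝒞} (h : Ext1Vanishes A B) (e : A' ≅ A) :
    Ext1Vanishes A' B := by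
  intro E f g w hS
  let S := ShortComplex.mk f (g ≫ e.hom) (by rw [reassoc_of% w, zero_comp])
  have hS' : S.ShortExact := ShortComplex.shortExact_of_iso
    (ShortComplex.isoMk (S₁ := ShortComplex.mk f g w) (S₂ := S) (Iso.refl _) (Iso.refl _) e
      (by simp [S]) (by simp [S])) hS
  obtain ⟨s, hs⟩ := h _ _ _ _ hS'
  exact ⟨e.hom ≫ s, by rw [Category.assoc, ← cancel_mono e.hom]; simp [hs]⟩

end YonedaVanishing

section ContractibleComplexes

/-- The split sequences `0 → M → M × M → M → 0`, whose splice is the product of the disk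
complexes on `M`. -/
noncomputable def SplicingData.contractible (M : ModuleCat.{u} R) : SplicingData R where
  Z _ := M
  X _ := ModuleCat.of R (M × M)
  ι _ := ModuleCat.ofHom (LinearMap.inr R M M)
  π _ := ModuleCat.ofHom (LinearMap.fst R M M)
  w _ := rfl
  shortExact _ := ModuleCat.shortComplex_shortExact _ (by
    rintro ⟨x, y⟩
    exact ⟨fun h => ⟨y, Prod.ext h.symm rfl⟩, fun ⟨z, hz⟩ => congr(($hz).1).symm⟩)
    LinearMap.inr_injective LinearMap.fst_surjective

lemma flat_prod_self (M : Type u) [AddCommGroup M] [Module R M] (hM : Module.Flat R M) :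
    Module.Flat R (M × M) :=
  .of_linearEquiv ((DFinsupp.linearEquivFunOnFintype (R := R) (M := fun _ : Fin 2 => M)).trans
    (LinearEquiv.finTwoArrow R M)).symm

lemma fTotallyAcyclic_contractible (M : ModuleCat.{u} R) (hM : Module.Flat R M) :
    FTotallyAcyclic (SplicingData.contractible M).complex :=
  SplicingData.fTotallyAcyclic_complex _ (fun _ => flat_prod_self M hM)
    fun _ I _ => Function.LeftInverse.injective
      (g := (LinearMap.snd R M M).lTensor I) fun x => by
        change ((LinearMap.snd R M M).lTensor I ∘ₗ (LinearMap.inr R M M).lTensor I) x = x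
        rw [← LinearMap.lTensor_comp, LinearMap.snd_comp_inr, LinearMap.lTensor_id]
        rfl

/-- Functoriality of the product of the disk complexes. -/
noncomputable def contractibleMap {M N : ModuleCat.{u} R} (f : M ⟶ N) :
    (SplicingData.contractible M).complex ⟶ (SplicingData.contractible N).complex where
  f _ := ModuleCat.ofHom (f.hom.prodMap f.hom)
  comm' := by
    rintro _ j rfl
    rw [SplicingData.complex_d, SplicingData.complex_d]
    ext x
    exact Prod.ext (map_zero f.hom).symm rfl

lemma contractibleMap_shortExact {S : ShortComplex (ModuleCat.{u} R)} (hS : S.ShortExact) :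
    (ShortComplex.mk (contractibleMap S.f) (contractibleMap S.g) (by
      ext n x
      exact Prod.ext (ConcreteCategory.congr_hom S.zero _)
        (ConcreteCategory.congr_hom S.zero _))).ShortExact := by
  refine HomologicalComplex.shortExact_of_degreewise_shortExact _ fun n =>
    ModuleCat.shortComplex_shortExact _ ?_
      (hS.moduleCat_injective_f.prodMap hS.moduleCat_injective_f)
      (hS.moduleCat_surjective_g.prodMap hS.moduleCat_surjective_g)
  have h := (ShortComplex.ShortExact.moduleCat_exact_iff_function_exact S).1 hS.exact
  rintro ⟨x, y⟩
  refine ⟨fun hxy => ?_, ?_⟩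
  · obtain ⟨a, ha⟩ := (h x).1 congr(($hxy).1)
    obtain ⟨b, hb⟩ := (h y).1 congr(($hxy).2)
    exact ⟨(a, b), Prod.ext ha hb⟩
  · rintro ⟨⟨a, b⟩, hab⟩
    exact Prod.ext ((h x).2 ⟨a, congr(($hab).1)⟩) ((h y).2 ⟨b, congr(($hab).2)⟩)

/-- The map from the product of the disk complexes on `M` to `Y` given by a family of maps
`M ⟶ Y n`. -/
noncomputable def contractibleDesc {M : ModuleCat.{u} R} {Y : ChainComplex (ModuleCat.{u} R) ℤ}
    (p : ∀ n, M ⟶ Y.X n) : (SplicingData.contractible M).complex ⟶ Y where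
  f n := ModuleCat.ofHom ((p n).hom.coprod (p (n + 1) ≫ Y.d (n + 1) n).hom)
  comm' := by
    rintro _ j rfl
    rw [SplicingData.complex_d]
    ext x
    have h := ConcreteCategory.congr_hom (Y.d_comp_d (j + 1 + 1) (j + 1) j) (p (j + 1 + 1) x.2)
    change Y.d (j + 1) j (p (j + 1) x.1 + Y.d (j + 1 + 1) (j + 1) (p (j + 1 + 1) x.2)) =
      p j 0 + Y.d (j + 1) j (p (j + 1) x.1)
    rw [map_zero, zero_add, map_add]
    exact add_eq_left.2 h

/-- If `Ext¹(F', Y) = 0` for all `F`-totally acyclic complexes of flats `F'`, then the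
components of `Y` are cotorsion. -/
lemma isCotorsionModule_X {Y : ChainComplex (ModuleCat.{u} R) ℤ}
    (hY : ∀ F' : ChainComplex (ModuleCat.{u} R) ℤ, FTotallyAcyclic F' → Ext1Vanishes F' Y)
    (m : ℤ) : IsCotorsionModule (Y.X m) := by
  intro A hA
  refine Ext1Vanishes.of_exists_retraction fun E f g w hS => ?_
  let p : ∀ n, Y.X m ⟶ Y.X n := fun n => if h : m = n then (Y.XIsoOfEq h).hom else 0
  obtain ⟨H, hH⟩ := (hY _ (fTotallyAcyclic_contractible _ hA)).exists_extension
    (contractibleMap_shortExact hS) (contractibleDesc p)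
  refine ⟨ModuleCat.ofHom (LinearMap.inl R E E) ≫ H.f m, ?_⟩
  ext x
  have h := ConcreteCategory.congr_hom congr(($hH).f m) (x, 0)
  change H.f m (f x, f 0) = p m x + (p (m + 1) ≫ Y.d (m + 1) m) 0 at h
  rw [map_zero, map_zero, add_zero] at h
  exact h.trans (by simp [p])

end ContractibleComplexes

section TwistedSums

variable {F Y : ChainComplex (ModuleCat.{u} R) ℤ} (φ : ∀ n, F.X (n + 1) ⟶ Y.X n)
  (hφ : ∀ n, φ (n + 1) ≫ Y.d (n + 1) n + F.d (n + 1 + 1) (n + 1) ≫ φ n = 0)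

/-- The extension of `F` by `Y` given by a degree `-1` map `φ : F ⟶ Y` which anticommutes with the
differentials. -/
noncomputable abbrev twistedSum : ChainComplex (ModuleCat.{u} R) ℤ :=
  ChainComplex.of (fun n => ModuleCat.of R (Y.X n × F.X n))
    (fun n => ModuleCat.ofHom (((Y.d (n + 1) n).hom.coprod (φ n).hom).prod
      ((F.d (n + 1) n).hom ∘ₗ LinearMap.snd R _ _))) fun n => by
    refine ModuleCat.hom_ext (LinearMap.ext fun x => ?_)
    have h1 := ConcreteCategory.congr_hom (Y.d_comp_d (n + 1 + 1) (n + 1) n) x.1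
    have h2 := ConcreteCategory.congr_hom (F.d_comp_d (n + 1 + 1) (n + 1) n) x.2
    have h3 := ConcreteCategory.congr_hom (hφ n) x.2
    refine Prod.ext ?_ h2
    change Y.d (n + 1) n (Y.d (n + 1 + 1) (n + 1) x.1 + φ (n + 1) x.2) +
      φ n (F.d (n + 1 + 1) (n + 1) x.2) = 0
    rw [map_add, add_assoc]
    exact (congrArg₂ (· + ·) h1 h3).trans (add_zero 0)

lemma twistedSum_d_apply (n : ℤ) (y : Y.X (n + 1)) (x : F.X (n + 1)) :
    (twistedSum φ hφ).d (n + 1) n (y, x) =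
      (Y.d (n + 1) n y + φ n x, F.d (n + 1) n x) :=
  ConcreteCategory.congr_hom (ChainComplex.of_d (fun n => ModuleCat.of R (Y.X n × F.X n))
    (fun n => ModuleCat.ofHom (((Y.d (n + 1) n).hom.coprod (φ n).hom).prod
      ((F.d (n + 1) n).hom ∘ₗ LinearMap.snd R _ _))) _) (y, x)

include hφ in
/-- If `Ext¹(F, Y) = 0`, then degree `-1` maps `F ⟶ Y` which anticommute with the differentials
are null-homotopic. -/
lemma Ext1Vanishes.exists_nullhomotopy (h : Ext1Vanishes F Y) :
    ∃ t : ∀ n, F.X n ⟶ Y.X n, ∀ n, φ n + t (n + 1) ≫ Y.d (n + 1) n = F.d (n + 1) n ≫ t n := by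
  let a : Y ⟶ twistedSum φ hφ :=
    { f := fun n => ModuleCat.ofHom (LinearMap.inl R (Y.X n) (F.X n))
      comm' := by
        rintro _ n rfl
        refine ModuleCat.hom_ext (LinearMap.ext fun x => ?_)
        have h := twistedSum_d_apply φ hφ n x 0
        rw [map_zero, map_zero, add_zero] at h
        exact h }
  let b : twistedSum φ hφ ⟶ F :=
    { f := fun n => ModuleCat.ofHom (LinearMap.snd R (Y.X n) (F.X n))
      comm' := by
        rintro _ n rfl
        refine ModuleCat.hom_ext (LinearMap.ext fun x => ?_)
        exact congr(($(twistedSum_d_apply φ hφ n x.1 x.2)).2).symm }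
  have hab : (ShortComplex.mk a b rfl).ShortExact :=
    HomologicalComplex.shortExact_of_degreewise_shortExact _ fun n =>
      ModuleCat.shortComplex_shortExact _
        (fun x => ⟨fun hx => ⟨x.1, Prod.ext rfl hx.symm⟩, fun ⟨y, hy⟩ => congr(($hy).2).symm⟩)
        (LinearMap.inl_injective (R := R) (M := Y.X n) (M₂ := F.X n))
        (LinearMap.snd_surjective (R := R) (M := Y.X n) (M₂ := F.X n))
  obtain ⟨s, hs⟩ := h _ _ _ _ hab
  refine ⟨fun n => s.f n ≫ ModuleCat.ofHom (LinearMap.fst R (Y.X n) (F.X n)), fun n => ?_⟩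
  ext x
  have h1 : (s.f (n + 1) x).2 = x := ConcreteCategory.congr_hom congr(($hs).f (n + 1)) x
  have h2 := ConcreteCategory.congr_hom (s.comm (n + 1) n) x
  have h3 := congr(($((twistedSum_d_apply φ hφ n (s.f (n + 1) x).1 (s.f (n + 1) x).2).symm.trans
    h2)).1)
  rw [h1] at h3
  exact (add_comm _ _).trans h3

end TwistedSums

section Main

lemma exists_lift_of_projective {P A B : ModuleCat.{u} R} [Projective P] (g : A ⟶ B) (f : P ⟶ B)
    (h : ∀ x, ∃ y, g y = f x) : ∃ k : P ⟶ A, k ≫ g = f := by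
  have : Module.Projective R P := (IsProjective.iff_projective P).2 inferInstance
  obtain ⟨k, hk⟩ := Module.projective_lifting_property g.hom.rangeRestrict
    (f.hom.codRestrict (LinearMap.range g.hom) h) g.hom.surjective_rangeRestrict
  exact ⟨ModuleCat.ofHom k, by ext x; exact congr(($hk x).1)⟩

/-- A map `E.X 1 ⟶ Y.X 0` inducing a map from `E.Z 1` to the cokernel of `Y.d 1 0` extends to a
degree `-1` map of complexes. -/
lemma SplicingData.exists_anticommuting_family [IsNoetherianRing R] (E : SplicingData R)
    (hP : ∀ n, 0 ≤ n → Projective (E.X n))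
    (hI : ∀ n, ∀ I : ModuleCat.{u} R, Module.Injective R I →
      Function.Injective ((E.ι n).hom.lTensor I))
    (Y : ChainComplex (ModuleCat.{u} R) ℤ) (hflat : ∀ n < 0, Module.Flat R (Y.X n))
    (hcot : ∀ n, IsCotorsionModule (Y.X n)) (hexact : ∀ n, 0 < n → Y.ExactAt n)
    (φ₀ : E.X (0 + 1) ⟶ Y.X 0) (θ : E.Z (0 + 1) ⟶ cokernel (Y.d 1 0))
    (hφ₀ : φ₀ ≫ cokernel.π (Y.d 1 0) = E.π (0 + 1) ≫ θ) :
    ∃ φ : ∀ n, E.complex.X (n + 1) ⟶ Y.X n, φ 0 = φ₀ ∧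
      ∀ n, φ (n + 1) ≫ Y.d (n + 1) n + E.complex.d (n + 1 + 1) (n + 1) ≫ φ n = 0 := by
  have h₀ : E.ι (0 + 1) ≫ φ₀ ≫ cokernel.π (Y.d 1 0) = 0 := by
    rw [hφ₀, reassoc_of% E.w, zero_comp]
  have hπ (x : E.X (0 + 1)) : cokernel.π (Y.d 1 0) (φ₀ x) = θ (E.π (0 + 1) x) :=
    ConcreteCategory.congr_hom hφ₀ x
  obtain ⟨φ, hφ, h⟩ := exists_int_family (α := fun n => E.X (n + 1) ⟶ Y.X n)
    (fun i j a b => b ≫ Y.d j i + E.complex.d (j + 1) (i + 1) ≫ a = 0)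
    (fun n a => (0 ≤ n → ∀ z, ∃ y, Y.d (n + 1) n y = a (E.ι (n + 1) z)) ∧
      ∀ k, E.ι (n + 1) ≫ a ≫ Y.d n k = 0)
    φ₀
    (by
      refine ⟨fun _ z => ?_, fun k => ?_⟩
      · exact ((ShortComplex.ShortExact.moduleCat_exact_iff_function_exact _).1
          (ShortComplex.exact_of_g_is_cokernel (ShortComplex.mk _ _ (cokernel.condition (Y.d 1 0)))
            (cokernelIsCokernel _)) _).1 (ConcreteCategory.congr_hom h₀ z)
      · rw [← cokernel.π_desc (Y.d 1 0) (Y.d 0 k) (by simp), reassoc_of% h₀, zero_comp])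
    (by
      rintro i _ rfl hi a ⟨ha, -⟩
      have := hP (i + 1 + 1) (by lia)
      have hd (x) : (E.complex.d (i + 1 + 1) (i + 1) ≫ a) x =
          a (E.ι (i + 1) (E.π (i + 1 + 1) x)) := by
        rw [E.complex_d]
        rfl
      obtain ⟨b, hb⟩ := exists_lift_of_projective (P := E.X (i + 1 + 1)) (Y.d (i + 1) i)
        (-(E.complex.d (i + 1 + 1) (i + 1) ≫ a)) fun x => by
          obtain ⟨y, hy⟩ := ha hi (E.π (i + 1 + 1) x)
          exact ⟨-y, (map_neg _ _).trans (congrArg Neg.neg (hy.trans (hd x).symm))⟩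
      have hdb (z) : ∃ y, Y.d (i + 1 + 1) (i + 1) y = b (E.ι (i + 1 + 1) z) := by
        refine ((exactAt_iff_function_exact _ _).1 (hexact (i + 1) (by lia)) _).1 ?_
        refine (ConcreteCategory.congr_hom hb _).trans (neg_eq_zero.2 ((hd _).trans ?_))
        rw [show E.π (i + 1 + 1) (E.ι (i + 1 + 1) z) = 0 from
          ConcreteCategory.congr_hom (E.w (i + 1 + 1)) z, map_zero, map_zero]
      refine ⟨b, ⟨fun _ => hdb, fun k => ?_⟩, by rw [hb, neg_add_cancel]⟩
      ext z
      obtain ⟨y, hy⟩ := hdb z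
      change Y.d (i + 1) k (b (E.ι (i + 1 + 1) z)) = 0
      rw [← hy]
      exact ConcreteCategory.congr_hom (Y.d_comp_d (i + 1 + 1) (i + 1) k) y)
    (by
      rintro i _ rfl hi b ⟨-, hb⟩
      let c := (E.shortExact (i + 1 + 1)).exact.desc (b ≫ Y.d (i + 1) i) (hb i)
      have hc : E.π (i + 1 + 1) ≫ c = b ≫ Y.d (i + 1) i :=
        (E.shortExact (i + 1 + 1)).exact.g_desc _ _
      obtain ⟨a, ha⟩ := exists_extension_of_lTensor_injective (E.ι (i + 1)) (hI (i + 1))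
        (hflat i (by lia)) (hcot i) (-c)
      refine ⟨a, ⟨by lia, fun k => ?_⟩, ?_⟩
      · rw [reassoc_of% ha, ← cancel_epi (E.π (i + 1 + 1)), Preadditive.neg_comp,
          Preadditive.comp_neg, reassoc_of% hc, Y.d_comp_d, comp_zero, neg_zero, comp_zero]
      · rw [E.complex_d, Category.assoc, ha, Preadditive.comp_neg, hc, add_neg_cancel])
  exact ⟨φ, hφ, fun n => h n (n + 1) rfl⟩

/-- Vanishing of `Ext¹(Z 0, coker (Y.d 1 0))` for spliced complexes. -/
lemma SplicingData.ext1Vanishes_cokernel [IsNoetherianRing R] (E : SplicingData R)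
    (hP : ∀ n, 0 ≤ n → Projective (E.X n))
    (hI : ∀ n, ∀ I : ModuleCat.{u} R, Module.Injective R I →
      Function.Injective ((E.ι n).hom.lTensor I))
    (Y : ChainComplex (ModuleCat.{u} R) ℤ) (hflat : ∀ n < 0, Module.Flat R (Y.X n))
    (hcot : ∀ n, IsCotorsionModule (Y.X n)) (hexact : ∀ n, 0 < n → Y.ExactAt n)
    (hE : Ext1Vanishes E.complex Y) : Ext1Vanishes (E.Z 0) (cokernel (Y.d 1 0)) := by
  intro M f g w hS
  have := hS.mono_f
  have := hS.epi_g
  have := hP 0 le_rfl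
  have := hP (0 + 1) (by lia)
  let e := Projective.factorThru (E.π 0) g
  have he : e ≫ g = E.π 0 := Projective.factorThru_comp _ _
  let θ : E.Z (0 + 1) ⟶ cokernel (Y.d 1 0) := hS.exact.lift (E.ι 0 ≫ e)
    (by rw [Category.assoc, he, E.w])
  have hθ : θ ≫ f = E.ι 0 ≫ e := hS.exact.lift_f _ _
  obtain ⟨φ, hφ₀, hφ⟩ := E.exists_anticommuting_family hP hI Y hflat hcot hexact _ θ
    (Projective.factorThru_comp (E.π (0 + 1) ≫ θ) (cokernel.π (Y.d 1 0)))
  obtain ⟨t, ht⟩ := hE.exists_nullhomotopy φ hφ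
  let k : E.X 0 ⟶ cokernel (Y.d 1 0) := t 0 ≫ cokernel.π (Y.d 1 0)
  have hk : E.ι 0 ≫ k = θ := by
    have h := ht 0 =≫ cokernel.π (Y.d 1 0)
    rw [Preadditive.add_comp, Category.assoc, Category.assoc, hφ₀, Projective.factorThru_comp,
      E.complex_d] at h
    have h' : t (0 + 1) ≫ Y.d (0 + 1) 0 ≫ cokernel.π (Y.d 1 0) = 0 :=
      (t (0 + 1) ≫= cokernel.condition (Y.d 1 0)).trans comp_zero
    rw [h', add_zero, Category.assoc] at h
    exact ((cancel_epi (E.π (0 + 1))).1 h).symm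
  have hs : E.ι 0 ≫ (e - k ≫ f) = 0 := by
    rw [Preadditive.comp_sub, reassoc_of% hk, hθ, sub_self]
  refine ⟨(E.shortExact 0).exact.desc _ hs, ?_⟩
  have h : E.π 0 ≫ (E.shortExact 0).exact.desc _ hs = e - k ≫ f :=
    (E.shortExact 0).exact.g_desc _ hs
  rw [← cancel_epi (E.π 0), reassoc_of% h, Preadditive.sub_comp, he, Category.assoc, w,
    comp_zero, sub_zero, Category.comp_id]

end Main

section Precover

variable {C : ModuleCat.{u} R} {Y F : ChainComplex (ModuleCat.{u} R) ℤ} {i : Y ⟶ F}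
  {p : F ⟶ (HomologicalComplex.single (ModuleCat.{u} R) (ComplexShape.down ℤ) 0).obj C}
  {w : i ≫ p = 0}

lemma isIso_f_of_shortExact_single (hses : (ShortComplex.mk i p w).ShortExact) {n : ℤ}
    (hn : n ≠ 0) : IsIso (i.f n) := by
  have h := (HomologicalComplex.shortExact_iff_degreewise_shortExact _).1 hses n
  exact h.isIso_f_iff.2 (HomologicalComplex.isZero_single_obj_X (ComplexShape.down ℤ) 0 C n hn)

lemma exactAt_of_shortExact_single (hses : (ShortComplex.mk i p w).ShortExact) {n : ℤ}
    (hn : 0 < n) (hF : F.ExactAt n) : Y.ExactAt n := by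
  obtain ⟨n, rfl⟩ : ∃ m, n = m + 1 := ⟨n - 1, by simp⟩
  have hinj (m : ℤ) : Function.Injective (i.f m) :=
    ((HomologicalComplex.shortExact_iff_degreewise_shortExact _).1 hses m).moduleCat_injective_f
  have hsurj : Function.Surjective (i.f (n + 1 + 1)) :=
    have := isIso_f_of_shortExact_single hses (n := n + 1 + 1) (by lia)
    (ModuleCat.epi_iff_surjective _).1 inferInstance
  have hcomm (m k : ℤ) (y : Y.X m) : i.f k (Y.d m k y) = F.d m k (i.f m y) :=
    (ConcreteCategory.congr_hom (i.comm m k) y).symm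
  rw [exactAt_iff_function_exact] at hF ⊢
  intro y
  rw [← map_eq_zero_iff (i.f n).hom (hinj n)]
  change i.f n (Y.d (n + 1) n y) = 0 ↔ _
  rw [hcomm, hF]
  refine ⟨?_, ?_⟩
  · rintro ⟨x, hx⟩
    obtain ⟨z, rfl⟩ := hsurj x
    exact ⟨z, hinj _ ((hcomm _ _ z).trans hx)⟩
  · rintro ⟨z, rfl⟩
    exact ⟨_, (hcomm _ _ z).symm⟩

end Precover

theorem gorensteinCotorsion_of_special_precover
    [IsNoetherianRing R]
    (C : ModuleCat.{u} R) (hC : IsCotorsionModule C)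
    (Y F : ChainComplex (ModuleCat.{u} R) ℤ)
    (i : Y ⟶ F)
    (p : F ⟶ (HomologicalComplex.single (ModuleCat.{u} R) (ComplexShape.down ℤ) 0).obj C)
    (w : i ≫ p = 0)
    (hses : (ShortComplex.mk i p w).ShortExact)
    (hF : FTotallyAcyclic F)
    (hY : ∀ F' : ChainComplex (ModuleCat.{u} R) ℤ, FTotallyAcyclic F' → Ext1Vanishes F' Y) :
    IsGorensteinCotorsion (cokernel (Y.d 1 0)) := by
  rintro G ⟨F', hF', ⟨e⟩⟩
  obtain ⟨E, hE₀, hflat, hP, hI⟩ := hF'.exists_splicingData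
  have h := E.ext1Vanishes_cokernel hP hI Y
    (fun n hn => by
      have := isIso_f_of_shortExact_single hses hn.ne
      have := hF.1 n
      exact .of_linearEquiv (asIso (i.f n)).toLinearEquiv)
    (isCotorsionModule_X hY) (fun n hn => exactAt_of_shortExact_single hses hn (hF.2.1 n))
    (hY _ (E.fTotallyAcyclic_complex hflat hI))
  rw [hE₀] at h
  exact h.of_iso e
end

section
/- Let R be a commutative Noetherian ring, I an injective R-module, and F an acyclic chain complex of R-modules all of whose cycle modules Z_n(F) are flat. Then the chain complex I ⊗_R F, obtained by applying the functor I ⊗_R − to F degreewise, is acyclic and every one of its cycle modules is an injective R-module. In particular, I ⊗_R F is a contractible complex of injective R-modules. -/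
/-!
STATEMENT 12: Let `R` be a commutative Noetherian ring, `I` an injective `R`-module and `F`
an acyclic chain complex of `R`-modules with flat cycle modules.  Then the complex `I ⊗[R] F`
(obtained by applying `I ⊗[R] -` degreewise) is acyclic with injective cycle modules; in
particular it is a contractible complex of injective `R`-modules.
-/

universe u

open CategoryTheory MonoidalCategory Limits

variable {R : Type u} [CommRing R]

/-- The chain complex obtained by applying `I ⊗[R] -` degreewise. -/
noncomputable def tensorCx (I : ModuleCat.{u} R) (F : ChainComplex (ModuleCat.{u} R) ℤ) :
    ChainComplex (ModuleCat.{u} R) ℤ :=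
  ((tensorLeft I).mapHomologicalComplex (ComplexShape.down ℤ)).obj F

theorem Module.Flat.baer_tensorProduct [IsNoetherianRing R] (P I : Type*) [AddCommGroup P]
    [Module R P] [Module.Flat R P] [AddCommGroup I] [Module R I] (hI : Module.Baer R I) :
    Module.Baer R (TensorProduct R P I) := by
  intro J g
  have := Module.finitePresentation_of_finite R J
  obtain ⟨n, m, a, b, ha, hab⟩ := Module.FinitePresentation.exists_fin' R J
  set e : Fin n → J := fun j => a (Pi.single j 1)
  set r : Fin m → Fin n → R := fun i => b (Pi.single i 1)
  have hr0 (i : Fin m) : ∑ j, r i j • e j = 0 := by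
    rw [← hab.apply_apply_eq_zero (Pi.single i 1), ← Finset.univ_sum_single (b (Pi.single i 1)),
      map_sum]
    refine Finset.sum_congr rfl fun j _ => ?_
    rw [← map_smul, ← Pi.single_smul, smul_eq_mul, mul_one]
  let α : I →ₗ[R] (Fin n → I) := LinearMap.pi fun j => (e j : R) • LinearMap.id
  let β : (Fin n → I) →ₗ[R] (Fin m → I) :=
    LinearMap.pi fun i => ∑ j, r i j • LinearMap.proj j
  have hαβ : Function.Exact α β := by
    intro x
    constructor
    · intro hx
      let x' : (Fin n → R) →ₗ[R] I := Fintype.linearCombination R x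
      have hx' : LinearMap.ker a ≤ LinearMap.ker x' := by
        intro v hv
        obtain ⟨w, hw⟩ := (hab v).1 hv
        have hcomp : x' ∘ₗ b = 0 := by
          refine LinearMap.pi_ext' fun i => LinearMap.ext_ring ?_
          simpa [β, x', Fintype.linearCombination_apply] using congrFun hx i
        have := LinearMap.congr_fun hcomp w
        simpa [hw] using this
      let φ : J →ₗ[R] I := (LinearMap.ker a).liftQ x' hx' ∘ₗ
        (a.quotKerEquivOfSurjective ha).symm.toLinearMap
      have hφ (v) : φ (a v) = x' v := by
        have : (a.quotKerEquivOfSurjective ha).symm (a v) = Submodule.Quotient.mk v := by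
          rw [LinearEquiv.symm_apply_eq]; rfl
        simp [φ, this]
      obtain ⟨ψ, hψ⟩ := hI J φ
      refine ⟨ψ 1, ?_⟩
      ext j
      have h1 : ψ (e j : R) = x j := by
        rw [hψ _ (e j).2]
        exact (hφ _).trans (by simp [x', Fintype.linearCombination_apply_single])
      simpa [α, ← map_smul] using h1
    · rintro ⟨z, rfl⟩
      ext i
      have := congrArg (fun t : J => (t : R) • z) (hr0 i)
      simpa [α, β, Finset.sum_smul, mul_smul] using this
  have hexact := Module.Flat.lTensor_exact P hαβ
  let y : Fin n → TensorProduct R P I := fun j => g (e j)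
  have hα (z) : TensorProduct.piRight R R P (fun _ => I) (α.lTensor P z) =
      fun j => (e j : R) • z := by
    induction z with
    | zero => ext; simp
    | add z w hz hw => rw [map_add, map_add, hz, hw]; ext; simp
    | tmul p x => ext; simp [α]
  have hβ (y) : TensorProduct.piRight R R P (fun _ => I) (β.lTensor P y) =
      fun i => ∑ j, r i j • TensorProduct.piRight R R P (fun _ => I) y j := by
    induction y with
    | zero => ext; simp
    | add z w hz hw =>
      rw [map_add, map_add, hz, hw]; ext; simp [Finset.sum_add_distrib]
    | tmul p x => ext; simp [β, TensorProduct.tmul_sum]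
  obtain ⟨z, hz⟩ := (hexact ((TensorProduct.piRight R R P (fun _ => I)).symm y)).1 (by
    apply (TensorProduct.piRight R R P (fun _ => I)).injective
    rw [hβ, map_zero]
    ext i
    simpa [y] using congrArg g (hr0 i))
  have hz' (j) : g (e j) = (e j : R) • z := by
    have h := hα z
    rw [hz, LinearEquiv.apply_symm_apply] at h
    exact congrFun h j
  refine ⟨LinearMap.toSpanSingleton R _ z, fun t ht => ?_⟩
  have hg : g ∘ₗ a = LinearMap.toSpanSingleton R _ z ∘ₗ J.subtype ∘ₗ a :=
    LinearMap.pi_ext' fun j => LinearMap.ext_ring (hz' j)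
  obtain ⟨v, hv⟩ := ha ⟨t, ht⟩
  have := LinearMap.congr_fun hg v
  simp only [LinearMap.comp_apply, hv] at this
  exact this.symm

theorem Module.Injective.tensorProduct_flat [IsNoetherianRing R] (I P : Type u) [AddCommGroup P]
    [Module R P] [Module.Flat R P] [AddCommGroup I] [Module R I] (hI : Module.Injective R I) :
    Module.Injective R (TensorProduct R I P) :=
  ((Module.Flat.baer_tensorProduct P I (.of_injective hI)).of_equiv
    (TensorProduct.comm R P I)).injective

theorem ModuleCat.shortExact_map_tensorLeft (I : ModuleCat.{u} R)
    {S : ShortComplex (ModuleCat.{u} R)} (hS : S.ShortExact) [Module.Flat R S.X₃] :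
    (S.map (tensorLeft I)).ShortExact := by
  have hex := (ShortComplex.ShortExact.moduleCat_exact_iff_function_exact S).1 hS.exact
  exact ModuleCat.shortComplex_shortExact _
    (lTensor_exact I (f := S.f.hom) (g := S.g.hom) hex hS.surjective_g)
    (LinearMap.lTensor_injective_of_exact_of_flat S.g.hom hS.surjective_g S.f.hom
      hS.injective_f hex I)
    (LinearMap.lTensor_surjective I (g := S.g.hom) hS.surjective_g)

namespace HomologicalComplex

variable {C D : Type*} [Category* C] [Category* D] [Abelian C] {ι : Type*}
  {c : ComplexShape ι} (K : HomologicalComplex C c)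

/-- The sequence `Z_i ⟶ K_i ⟶ Z_j` attached to a differential `K.d i j`. -/
noncomputable abbrev cyclesShortComplex (i j : ι) : ShortComplex C :=
  .mk (K.iCycles i) (K.toCycles i j) (by simp [← cancel_mono (K.iCycles j)])

variable {K}

theorem ExactAt.epi_toCycles {i j : ι} (hij : c.Rel i j) (h : K.ExactAt j) :
    Epi (K.toCycles i j) := by
  obtain rfl := c.prev_eq' hij
  exact ShortComplex.Exact.epi_toCycles h

theorem ExactAt.shortExact_cyclesShortComplex {i j : ι} (hij : c.Rel i j) (h : K.ExactAt j) :
    (K.cyclesShortComplex i j).ShortExact := by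
  refine .mk' (ShortComplex.exact_of_f_is_kernel _ ?_) inferInstance (h.epi_toCycles hij)
  exact isKernelOfComp _ (K.d i j) (K.cyclesIsKernel i j (c.next_eq' hij)) _ (K.toCycles_i i j)

variable (Φ : C ⥤ D)

theorem map_toCycles_map_iCycles (i j : ι) :
    Φ.map (K.toCycles i j) ≫ Φ.map (K.iCycles j) = Φ.map (K.d i j) := by
  rw [← Φ.map_comp, toCycles_i]

variable [Abelian D] [Φ.Additive]

theorem exactAt_mapHomologicalComplex {i j k l : ι} (hij : c.Rel i j) (hjk : c.Rel j k)
    (h₁ : ((K.cyclesShortComplex i j).map Φ).ShortExact)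
    (h₂ : ((K.cyclesShortComplex j k).map Φ).ShortExact)
    (h₃ : ((K.cyclesShortComplex k l).map Φ).ShortExact) :
    ((Φ.mapHomologicalComplex c).obj K).ExactAt j := by
  rw [exactAt_iff' _ i j k (c.prev_eq' hij) (c.next_eq' hjk)]
  have : Epi (Φ.map (K.toCycles i j)) := h₁.epi_g
  have : Mono (Φ.map (K.iCycles k)) := h₃.mono_f
  let S : ShortComplex D := .mk (Φ.map (K.d i j)) (Φ.map (K.toCycles j k)) (by
    rw [← Φ.map_comp, d_toCycles, Φ.map_zero])
  let f : S ⟶ (K.cyclesShortComplex j k).map Φ :=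
    { τ₁ := Φ.map (K.toCycles i j)
      τ₂ := 𝟙 _
      τ₃ := 𝟙 _
      comm₁₂ := (map_toCycles_map_iCycles Φ i j).trans (Category.comp_id _).symm
      comm₂₃ := (Category.id_comp _).trans (Category.comp_id _).symm }
  let g : S ⟶ ((Φ.mapHomologicalComplex c).obj K).sc' i j k :=
    { τ₁ := 𝟙 _
      τ₂ := 𝟙 _
      τ₃ := Φ.map (K.iCycles k)
      comm₁₂ := (Category.id_comp _).trans (Category.comp_id _).symm
      comm₂₃ := (Category.id_comp _).trans (map_toCycles_map_iCycles Φ j k).symm }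
  have : Epi f.τ₁ := ‹Epi (Φ.map (K.toCycles i j))›
  have : IsIso f.τ₂ := inferInstanceAs (IsIso (𝟙 _))
  have : Mono f.τ₃ := inferInstanceAs (Mono (𝟙 _))
  have : Epi g.τ₁ := inferInstanceAs (Epi (𝟙 _))
  have : IsIso g.τ₂ := inferInstanceAs (IsIso (𝟙 _))
  have : Mono g.τ₃ := ‹Mono (Φ.map (K.iCycles k))›
  rw [← ShortComplex.exact_iff_of_epi_of_isIso_of_mono g,
    ShortComplex.exact_iff_of_epi_of_isIso_of_mono f]
  exact h₂.exact

/-- `Φ` commutes with cycles when it preserves the relevant short exact sequences. -/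
noncomputable def cyclesMapHomologicalComplexIso {i j k : ι} (hij : c.Rel i j)
    (h₁ : ((K.cyclesShortComplex i j).map Φ).ShortExact)
    (h₂ : ((K.cyclesShortComplex j k).map Φ).ShortExact) :
    Φ.obj (K.cycles i) ≅ ((Φ.mapHomologicalComplex c).obj K).cycles i :=
  IsLimit.conePointUniqueUpToIso
    (isKernelCompMono h₁.fIsKernel (Φ.map (K.iCycles j)) (hg := h₂.mono_f)
      (map_toCycles_map_iCycles Φ i j).symm)
    (((Φ.mapHomologicalComplex c).obj K).cyclesIsKernel i j (c.next_eq' hij))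

/-- A complex whose cycle sequences split is contractible. -/
noncomputable def homotopyOfSplitting (K : ChainComplex C ℤ)
    (s : ∀ i j, (ComplexShape.down ℤ).Rel i j → (K.cyclesShortComplex i j).Splitting) :
    Homotopy (𝟙 K) 0 where
  hom i j := if h : (ComplexShape.down ℤ).Rel j i then
      (s i (i - 1) (by simp)).r ≫ (s j i h).s else 0
  zero i j h := dif_neg h
  comm i := by
    have h₁ : (ComplexShape.down ℤ).Rel i (i - 1) := by simp
    have h₂ : (ComplexShape.down ℤ).Rel (i + 1) i := by simp
    rw [dNext_eq _ h₁, prevD_eq _ h₂, dif_pos h₁, dif_pos h₂]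
    have e₁ := (s (i - 1) (i - 1 - 1) (by simp)).f_r
    have e₂ := (s (i + 1) i h₂).s_g
    have e₃ := (s i (i - 1) h₁).id
    dsimp only at e₁ e₂ e₃
    rw [← K.toCycles_i i (i - 1), ← K.toCycles_i (i + 1) i, Category.assoc, reassoc_of% e₁,
      Category.assoc, reassoc_of% e₂]
    simpa using e₃.symm.trans (add_comm _ _)

end HomologicalComplex

theorem tensor_acyclic_complex_of_flats_with_injective
    [IsNoetherianRing R]
    (I : ModuleCat.{u} R) (hI : Module.Injective R I)
    (F : ChainComplex (ModuleCat.{u} R) ℤ)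
    (hacyclic : ∀ n, F.ExactAt n)
    (hflatcycles : ∀ n, Module.Flat R (F.cycles n)) :
    (∀ n, (tensorCx I F).ExactAt n) ∧
      (∀ n, Module.Injective R ((tensorCx I F).cycles n)) ∧
      (∀ n, Module.Injective R ((tensorCx I F).X n)) ∧
      Nonempty (Homotopy (𝟙 (tensorCx I F)) 0) := by
  have hrel (n : ℤ) : (ComplexShape.down ℤ).Rel n (n - 1) := by simp
  have hrel' (n : ℤ) : (ComplexShape.down ℤ).Rel (n + 1) n := by simp
  have hS (i j : ℤ) (hij : (ComplexShape.down ℤ).Rel i j) :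
      ((F.cyclesShortComplex i j).map (tensorLeft I)).ShortExact :=
    have : Module.Flat R (F.cyclesShortComplex i j).X₃ := hflatcycles j
    ModuleCat.shortExact_map_tensorLeft I ((hacyclic j).shortExact_cyclesShortComplex hij)
  have hT (n : ℤ) : (tensorCx I F).ExactAt n :=
    HomologicalComplex.exactAt_mapHomologicalComplex _ (hrel' n) (hrel n) (hS _ _ (hrel' n))
      (hS _ _ (hrel n)) (hS _ _ (hrel _))
  have hZ (n : ℤ) : Injective ((tensorCx I F).cycles n) :=
    have : Module.Injective R ((tensorLeft I).obj (F.cycles n)) :=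
      Module.Injective.tensorProduct_flat I (F.cycles n) hI
    .of_iso (HomologicalComplex.cyclesMapHomologicalComplexIso _ (hrel n) (hS _ _ (hrel n))
      (hS _ _ (hrel _))) (Module.injective_object_of_injective_module R _ (inj := this))
  let s (i j : ℤ) (hij : (ComplexShape.down ℤ).Rel i j) :
      ((tensorCx I F).cyclesShortComplex i j).Splitting :=
    ((hT j).shortExact_cyclesShortComplex hij).splittingOfInjective
  refine ⟨hT, fun n => ?_, fun n => ?_, ⟨HomologicalComplex.homotopyOfSplitting _ s⟩⟩
  · have := hZ n
    exact Module.injective_module_of_injective_object R _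
  · have : Injective ((tensorCx I F).X n) :=
      .of_iso (s n (n - 1) (hrel n)).isoBinaryBiproduct.symm inferInstance
    exact Module.injective_module_of_injective_object R _
end

section
/- Let R be a commutative Noetherian ring, D a bounded chain complex of injective R-modules (D_n is injective for all n, and D_n = 0 for all but finitely many n), and E a chain complex of injective R-modules. Then for every integer n, the degree-n component of the Hom-complex Hom(D, E), namely the R-module ∏_{k ∈ ℤ} Hom_R(D_k, E_{k+n}), is flat and cotorsion; that is, it is a flat R-module and Ext^1_R(F, ∏_{k ∈ ℤ} Hom_R(D_k, E_{k+n})) = 0 for every flat R-module F. -/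
/-!
STATEMENT 15: Let `R` be a commutative Noetherian ring, `D` a bounded chain complex of
injective `R`-modules and `E` a chain complex of injective `R`-modules.  Then for every
`n : ℤ`, the degree-`n` component `∏ k, Hom_R(D k, E (k + n))` of the Hom-complex
`Hom(D, E)` is a flat and cotorsion `R`-module.

The vanishing of the (Yoneda) group `Ext¹(A, B)` is expressed by the (equivalent)
statement that every short exact sequence `0 → B → E → A → 0` splits.
-/

universe u

open CategoryTheory Limits

/-- An `R`-module `M` is cotorsion if `Ext¹_R(F, M) = 0` for every flat `R`-module `F`. -/
def IsCotorsion (R : Type u) [CommRing R] (M : Type u) [AddCommGroup M] [Module R M] : Prop :=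
  ∀ F : ModuleCat.{u} R, Module.Flat R F → Ext1Vanishes F (ModuleCat.of R M)

/-- A map into an injective module factors through any map with a smaller kernel. -/
lemma Module.Injective.exists_comp_eq_of_ker_le {R I : Type u} {P N : Type*}
    [CommRing R] [AddCommGroup I] [Module R I] [AddCommGroup P] [Module R P]
    [AddCommGroup N] [Module R N] [Module.Injective R I] (p : P →ₗ[R] N) (q : P →ₗ[R] I)
    (h : LinearMap.ker p ≤ LinearMap.ker q) : ∃ r : N →ₗ[R] I, r ∘ₗ p = q := by
  obtain ⟨r, hr⟩ := Module.Injective.extension_property R I _ _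
    ((LinearMap.ker p).liftQ p le_rfl)
    (LinearMap.ker_eq_bot.mp (Submodule.ker_liftQ_eq_bot _ _ _ le_rfl))
    ((LinearMap.ker p).liftQ q h)
  refine ⟨r, LinearMap.ext fun x => ?_⟩
  simpa using LinearMap.congr_fun hr (Submodule.Quotient.mk x)

/-- If the columns of `a` generate the relations among the `f i` and `D` is injective, then every
`v` in `Dˡ` annihilated by the transpose of `a` is of the form `i ↦ f i • d`. -/
lemma Module.Injective.exists_smul_eq_of_forall_sum_smul_eq_zero {R D : Type u} [CommRing R]
    [AddCommGroup D] [Module R D] [Module.Injective R D] {ι κ : Type*} [Fintype ι]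
    {f : ι → R} {a : κ → ι → R}
    (ha : ∀ w : ι → R, ∑ i, w i * f i = 0 → w ∈ Submodule.span R (Set.range a))
    {v : ι → D} (hv : ∀ j, ∑ i, a j i • v i = 0) : ∃ d : D, ∀ i, f i • d = v i := by
  classical
  obtain ⟨r, hr⟩ := Module.Injective.exists_comp_eq_of_ker_le
    (Fintype.linearCombination R f) (Fintype.linearCombination R v) (fun w hw => by
      refine (Submodule.span_le (p := LinearMap.ker (Fintype.linearCombination R v))).mpr ?_
        (ha w (by simpa [Fintype.linearCombination_apply] using hw))
      rintro _ ⟨j, rfl⟩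
      simpa [Fintype.linearCombination_apply] using hv j)
  refine ⟨r 1, fun i => ?_⟩
  simpa [← map_smul] using LinearMap.congr_fun hr (Pi.single i 1)

/-- With `a` generating the relations among the `f i`, every relation `∑ i, f i • x i = 0` between
linear maps of injective modules is trivialized by the coefficients `a`. -/
lemma Module.Injective.exists_linearMap_eq_sum_smul {R D E : Type u} [CommRing R]
    [AddCommGroup D] [Module R D] [AddCommGroup E] [Module R E] [Module.Injective R D]
    [Module.Injective R E] {ι κ : Type*} [Fintype ι] [Fintype κ] {f : ι → R} {a : κ → ι → R}
    (ha : ∀ w : ι → R, ∑ i, w i * f i = 0 → w ∈ Submodule.span R (Set.range a))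
    {x : ι → D →ₗ[R] E} (hx : ∑ i, f i • x i = 0) :
    ∃ y : κ → D →ₗ[R] E, ∀ i, x i = ∑ j, a j i • y j := by
  classical
  let A : (ι → D) →ₗ[R] (κ → D) :=
    LinearMap.pi fun j => ∑ i, a j i • LinearMap.proj i
  obtain ⟨Y, hY⟩ := Module.Injective.exists_comp_eq_of_ker_le A
    (∑ i, x i ∘ₗ LinearMap.proj i) (fun v hv => by
      obtain ⟨d, hd⟩ := Module.Injective.exists_smul_eq_of_forall_sum_smul_eq_zero ha (v := v)
        (fun j => by simpa [A] using congrFun (LinearMap.mem_ker.mp hv) j)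
      simpa [← hd] using LinearMap.congr_fun hx d)
  refine ⟨fun j => Y ∘ₗ LinearMap.single R (fun _ => D) j, fun i => LinearMap.ext fun d => ?_⟩
  have h := LinearMap.congr_fun hY (Pi.single i d)
  have hA : A (Pi.single i d) = ∑ j, a j i • Pi.single j d := by
    ext j
    simp [A, Pi.single_apply, Finset.sum_apply]
  rw [LinearMap.comp_apply, hA] at h
  simpa [Pi.single_apply, apply_ite] using h.symm

/-- Over a Noetherian ring, a product of modules `Hom(D, E)` with `D` and `E` injective is flat. -/
lemma Module.Flat.pi_linearMap_of_injective {R : Type u} [CommRing R] [IsNoetherianRing R]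
    {ι : Type*} (D E : ι → Type u) [∀ k, AddCommGroup (D k)] [∀ k, Module R (D k)]
    [∀ k, AddCommGroup (E k)] [∀ k, Module R (E k)] [∀ k, Module.Injective R (D k)]
    [∀ k, Module.Injective R (E k)] : Module.Flat R (∀ k, D k →ₗ[R] E k) := by
  refine Module.Flat.of_forall_isTrivialRelation fun {l f x} hx => ?_
  obtain ⟨m, a, ha⟩ := Submodule.fg_iff_exists_fin_generating_family.mp
    (IsNoetherian.noetherian (LinearMap.ker (Fintype.linearCombination R f)))
  have ha' (w : Fin l → R) (hw : ∑ i, w i * f i = 0) :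
      w ∈ Submodule.span R (Set.range a) := by
    simpa [ha, Fintype.linearCombination_apply] using hw
  have hx' (k) : ∑ i, f i • x i k = 0 := by simpa using congrFun hx k
  choose y hy using fun k => Module.Injective.exists_linearMap_eq_sum_smul ha' (hx' k)
  refine ⟨m, fun i j => a j i, fun j k => y k j, fun i => ?_, fun j => ?_⟩
  · ext1 k
    simpa using hy k i
  · have h : a j ∈ LinearMap.ker (Fintype.linearCombination R f) :=
      ha ▸ Submodule.subset_span ⟨j, rfl⟩
    simpa [Fintype.linearCombination_apply, mul_comm] using h

/-- The character module functor is exact. -/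
lemma CharacterModule.exact_dual {R : Type*} [CommRing R] {A B C : Type*} [AddCommGroup A]
    [AddCommGroup B] [AddCommGroup C] [Module R A] [Module R B] [Module R C] {f : A →ₗ[R] B}
    {g : B →ₗ[R] C} (hfg : Function.Exact f g) (hg : Function.Surjective g) :
    Function.Exact (CharacterModule.dual g) (CharacterModule.dual f) := by
  intro c
  constructor
  · intro hc
    refine ⟨AddMonoidHom.liftOfSurjective g.toAddMonoidHom hg ⟨c, fun b hb => ?_⟩, ?_⟩
    · obtain ⟨a, rfl⟩ := (hfg b).mp hb
      exact DFunLike.congr_fun hc a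
    · ext b
      exact AddMonoidHom.liftOfRightInverse_comp_apply g.toAddMonoidHom _
        (Function.rightInverse_surjInv hg) _ b
  · rintro ⟨c, rfl⟩
    ext a
    exact (congrArg c (hfg.apply_apply_eq_zero a)).trans (map_zero c)

/-- A short exact sequence with flat cokernel is pure. -/
lemma LinearMap.rTensor_injective_of_exact_of_flat {R A B F : Type u} [CommRing R]
    [AddCommGroup A] [AddCommGroup B] [AddCommGroup F] [Module R A] [Module R B] [Module R F]
    [Module.Flat R F] {f : A →ₗ[R] B} {g : B →ₗ[R] F} (hf : Function.Injective f)
    (hfg : Function.Exact f g) (hg : Function.Surjective g) (D : Type u) [AddCommGroup D]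
    [Module R D] : Function.Injective (f.rTensor D) := by
  have : Module.Injective R (CharacterModule F) :=
    Module.Flat.iff_characterModule_injective.mp inferInstance
  have hg' := CharacterModule.dual_injective_of_surjective g hg
  obtain ⟨r, hr⟩ := Module.Injective.extension_property R _ _ _
    (CharacterModule.dual g) hg' LinearMap.id
  have hsplit := ((CharacterModule.exact_dual hfg hg).split_tfae hg'
    (CharacterModule.dual_surjective_of_injective f hf)).out 0 1
  obtain ⟨s, hs⟩ := hsplit.mpr ⟨r, hr⟩
  rw [rTensor_injective_iff_lcomp_surjective]
  intro φ
  let flip {M N : Type u} [AddCommGroup M] [AddCommGroup N] [Module R M] [Module R N]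
      (φ : M →ₗ[R] CharacterModule N) : N →ₗ[R] CharacterModule M :=
    CharacterModule.curry
      (CharacterModule.dual (TensorProduct.comm R N M).toLinearMap (CharacterModule.uncurry φ))
  refine ⟨flip (s ∘ₗ flip φ), ?_⟩
  ext a d
  exact DFunLike.congr_fun (LinearMap.congr_fun hs (flip φ d)) a

/-- A product of modules `Hom(D, E)` with `E` injective is cotorsion. -/
lemma isCotorsion_pi_linearMap_of_injective {R : Type u} [CommRing R] {ι : Type}
    (D E : ι → Type u) [∀ k, AddCommGroup (D k)] [∀ k, Module R (D k)]
    [∀ k, AddCommGroup (E k)] [∀ k, Module R (E k)] [∀ k, Module.Injective R (E k)] :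
    IsCotorsion R (∀ k, D k →ₗ[R] E k) := by
  intro F hF X f g w hS
  have hext (k : ι) : ∃ h : X →ₗ[R] D k →ₗ[R] E k, h ∘ₗ f.hom = LinearMap.proj k := by
    obtain ⟨h, hh⟩ := Module.Injective.extension_property R (E k) _ _ (f.hom.rTensor (D k))
      (LinearMap.rTensor_injective_of_exact_of_flat hS.moduleCat_injective_f
        ((ShortComplex.ShortExact.moduleCat_exact_iff_function_exact _).mp hS.exact)
        hS.moduleCat_surjective_g (D k))
      (TensorProduct.lift (LinearMap.proj k))
    refine ⟨TensorProduct.curry h, LinearMap.ext fun m => LinearMap.ext fun d => ?_⟩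
    simpa using LinearMap.congr_fun hh (TensorProduct.tmul R m d)
  choose h hh using hext
  have hg : Epi g := hS.epi_g
  let σ := ShortComplex.Splitting.ofExactOfRetraction _ hS.exact (ModuleCat.ofHom (LinearMap.pi h))
    (by
      ext m k d
      exact LinearMap.congr_fun (LinearMap.congr_fun (hh k) m) d) hg
  exact ⟨σ.s, σ.s_g⟩

theorem flat_and_cotorsion_homComplex_components
    (R : Type u) [CommRing R] [IsNoetherianRing R]
    (D E : ChainComplex (ModuleCat.{u} R) ℤ)
    (hDinj : ∀ k, Module.Injective R (D.X k))
    (hDbdd : {k : ℤ | ¬ IsZero (D.X k)}.Finite)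
    (hEinj : ∀ k, Module.Injective R (E.X k)) (n : ℤ) :
    Module.Flat R (∀ k : ℤ, D.X k →ₗ[R] E.X (k + n)) ∧
      IsCotorsion R (∀ k : ℤ, D.X k →ₗ[R] E.X (k + n)) := by
  have := hDinj
  have := hEinj
  exact ⟨Module.Flat.pi_linearMap_of_injective (fun k => D.X k) (fun k => E.X (k + n)),
    isCotorsion_pi_linearMap_of_injective (fun k => D.X k) (fun k => E.X (k + n))⟩
end

section
/- Let R be a commutative Noetherian ring that is Iwanaga–Gorenstein, i.e. R has finite injective dimension as a module over itself. Then for an R-module T, the following are equivalent: (i) Ext^1_R(T, G) = 0 for every Gorenstein injective R-module G; (ii) T has finite projective dimension. -/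
/-!
STATEMENT 16: Let `R` be a commutative Noetherian ring which is Iwanaga–Gorenstein (i.e. `R`
has finite injective dimension as a module over itself).  Then for an `R`-module `T`, one has
`Ext¹_R(T, G) = 0` for every Gorenstein injective `R`-module `G` if and only if `T` has
finite projective dimension.

The vanishing of the (Yoneda) group `Ext¹(A, B)` is expressed by the (equivalent)
statement that every short exact sequence `0 → B → E → A → 0` splits.
-/

universe u

open CategoryTheory Limits

variable {R : Type u} [CommRing R]

/-- An `R`-module `M` is Gorenstein injective if `M ≅ Z₀ J` for some acyclic complex `J` of
injective `R`-modules such that `Hom_R(E, J)` is acyclic for every injective `R`-module `E`. -/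
def IsGorensteinInjective (M : ModuleCat.{u} R) : Prop :=
  ∃ J : ChainComplex (ModuleCat.{u} R) ℤ,
    (∀ n, Module.Injective R (J.X n)) ∧ (∀ n, J.ExactAt n) ∧
    (∀ E : ModuleCat.{u} R, Module.Injective R E →
      ∀ n, (((preadditiveCoyoneda.obj (Opposite.op E)).mapHomologicalComplex
        (ComplexShape.down ℤ)).obj J).ExactAt n) ∧
    Nonempty (M ≅ J.cycles 0)

/-- An `R`-module `M` has finite injective dimension if there is an exact coresolution
`0 → M → J⁰ → J¹ → ⋯ → Jⁿ → 0` by injective modules. -/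
def HasFiniteInjectiveDimension (M : ModuleCat.{u} R) : Prop :=
  ∃ (n : ℕ) (J : CochainComplex (ModuleCat.{u} R) ℕ) (ι : M ⟶ J.X 0),
    (∀ i, Module.Injective R (J.X i)) ∧ (∀ i, n < i → IsZero (J.X i)) ∧
    Mono ι ∧ ∃ w : ι ≫ J.d 0 1 = 0,
      (ShortComplex.mk ι (J.d 0 1) w).Exact ∧
      ∀ i, (ShortComplex.mk (J.d i (i + 1)) (J.d (i + 1) (i + 2))
        (J.d_comp_d i (i + 1) (i + 2))).Exact

/-- An `R`-module `M` has finite projective dimension if there is an exact resolution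
`0 → Pₙ → ⋯ → P₀ → M → 0` by projective modules. -/
def HasFiniteProjectiveDimension (M : ModuleCat.{u} R) : Prop :=
  ∃ (n : ℕ) (P : ChainComplex (ModuleCat.{u} R) ℕ) (π : P.X 0 ⟶ M),
    (∀ i, Module.Projective R (P.X i)) ∧ (∀ i, n < i → IsZero (P.X i)) ∧
    Epi π ∧ ∃ w : P.d 1 0 ≫ π = 0,
      (ShortComplex.mk (P.d 1 0) π w).Exact ∧
      ∀ i, (ShortComplex.mk (P.d (i + 2) (i + 1)) (P.d (i + 1) i)
        (P.d_comp_d (i + 2) (i + 1) i)).Exact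

namespace CategoryTheory.Abelian.Ext

universe w v₀ u₀

variable {C : Type u₀} [Category.{v₀} C] [Abelian C] [HasExt.{w} C] {S : ShortComplex C}

lemma subsingleton_X₃_of_X₁ (hS : S.ShortExact) {X : C} {n m : ℕ} (hnm : n + 1 = m)
    (h₂ : Subsingleton (Ext.{w} X S.X₂ n)) (h₁ : Subsingleton (Ext.{w} X S.X₁ m)) :
    Subsingleton (Ext.{w} X S.X₃ n) :=
  subsingleton_of_forall_eq 0 fun x ↦ by
    obtain ⟨y, rfl⟩ := covariant_sequence_exact₃ X hS x hnm (Subsingleton.elim _ _)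
    rw [Subsingleton.elim y 0, zero_comp]

lemma subsingleton_X₁_of_X₃ (hS : S.ShortExact) {X : C} {n m : ℕ} (hnm : n + 1 = m)
    (h₂ : Subsingleton (Ext.{w} X S.X₂ m)) (h₃ : Subsingleton (Ext.{w} X S.X₃ n)) :
    Subsingleton (Ext.{w} X S.X₁ m) :=
  subsingleton_of_forall_eq 0 fun x ↦ by
    obtain ⟨y, rfl⟩ := covariant_sequence_exact₁ X hS x (Subsingleton.elim _ _) hnm
    rw [Subsingleton.elim y 0, zero_comp]

lemma subsingleton_contravariant_X₁_of_X₃ (hS : S.ShortExact) {Y : C} {n m : ℕ} (hnm : 1 + n = m)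
    (h₂ : Subsingleton (Ext.{w} S.X₂ Y n)) (h₃ : Subsingleton (Ext.{w} S.X₃ Y m)) :
    Subsingleton (Ext.{w} S.X₁ Y n) :=
  subsingleton_of_forall_eq 0 fun x ↦ by
    obtain ⟨y, rfl⟩ := contravariant_sequence_exact₁ hS Y x hnm (Subsingleton.elim _ _)
    rw [Subsingleton.elim y 0, comp_zero]

lemma subsingleton_contravariant_X₃_of_X₁ (hS : S.ShortExact) {Y : C} {n m : ℕ} (hnm : 1 + n = m)
    (h₂ : Subsingleton (Ext.{w} S.X₂ Y m)) (h₁ : Subsingleton (Ext.{w} S.X₁ Y n)) :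
    Subsingleton (Ext.{w} S.X₃ Y m) :=
  subsingleton_of_forall_eq 0 fun x ↦ by
    obtain ⟨y, rfl⟩ := contravariant_sequence_exact₃ hS Y x (Subsingleton.elim _ _) hnm
    rw [Subsingleton.elim y 0, comp_zero]

/-- If `Ext¹(X, S.X₁) = 0`, then every morphism `X ⟶ S.X₃` lifts to `S.X₂`. -/
lemma exists_lift_of_subsingleton (hS : S.ShortExact) {X : C}
    (h : Subsingleton (Ext.{w} X S.X₁ 1)) (φ : X ⟶ S.X₃) : ∃ ψ : X ⟶ S.X₂, ψ ≫ S.g = φ := by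
  obtain ⟨y, hy⟩ := covariant_sequence_exact₃ X hS (mk₀ φ) (zero_add 1) (Subsingleton.elim _ _)
  obtain ⟨ψ, rfl⟩ := (mk₀_bijective X S.X₂).2 y
  refine ⟨ψ, (mk₀_bijective X S.X₃).1 ?_⟩
  rw [← hy, mk₀_comp_mk₀]

/-- If `Ext¹(S.X₃, Y) = 0`, then every morphism `S.X₁ ⟶ Y` extends to `S.X₂`. -/
lemma exists_extension_of_subsingleton (hS : S.ShortExact) {Y : C}
    (h : Subsingleton (Ext.{w} S.X₃ Y 1)) (φ : S.X₁ ⟶ Y) : ∃ ψ : S.X₂ ⟶ Y, S.f ≫ ψ = φ := by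
  obtain ⟨y, hy⟩ := contravariant_sequence_exact₁ hS Y (mk₀ φ) (add_zero 1)
    (Subsingleton.elim _ _)
  obtain ⟨ψ, rfl⟩ := (mk₀_bijective S.X₂ Y).2 y
  refine ⟨ψ, (mk₀_bijective S.X₁ Y).1 ?_⟩
  rw [← hy, mk₀_comp_mk₀]

/-- If every morphism `S.X₁ ⟶ Y` extends to the projective object `S.X₂`, then
`Ext¹(S.X₃, Y) = 0`. -/
lemma subsingleton_ext_one_of_forall_extension (hS : S.ShortExact) [Projective S.X₂] {Y : C}
    (h : ∀ φ : S.X₁ ⟶ Y, ∃ ψ : S.X₂ ⟶ Y, S.f ≫ ψ = φ) : Subsingleton (Ext.{w} S.X₃ Y 1) :=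
  subsingleton_of_forall_eq 0 fun x ↦ by
    obtain ⟨y, rfl⟩ := contravariant_sequence_exact₃ hS Y x (eq_zero_of_projective _) (add_zero 1)
    obtain ⟨φ, rfl⟩ := (mk₀_bijective S.X₁ Y).2 y
    obtain ⟨ψ, rfl⟩ := h φ
    rw [← mk₀_comp_mk₀, hS.extClass_comp_assoc]

end CategoryTheory.Abelian.Ext

namespace CharacterModule

variable {A B C : Type*} [AddCommGroup A] [AddCommGroup B] [AddCommGroup C]
  [Module R A] [Module R B] [Module R C]

lemma dual_exact {f : A →ₗ[R] B} {g : B →ₗ[R] C} (h : Function.Exact f g) :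
    Function.Exact (dual g) (dual f) := by
  refine fun c ↦ ⟨fun hc ↦ ?_, ?_⟩
  · let c₀ : CharacterModule (LinearMap.range g) :=
      AddMonoidHom.liftOfSurjective g.rangeRestrict.toAddMonoidHom g.surjective_rangeRestrict
        ⟨c, fun b hb ↦ by
          obtain ⟨a, rfl⟩ := (h b).1 (by simpa using congr_arg Subtype.val hb)
          exact DFunLike.congr_fun hc a⟩
    obtain ⟨d, hd⟩ := dual_surjective_of_injective (LinearMap.range g).subtype
      (Submodule.subtype_injective _) c₀
    refine ⟨d, ?_⟩
    ext b
    refine (DFunLike.congr_fun hd (g.rangeRestrict b)).trans ?_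
    exact AddMonoidHom.liftOfRightInverse_comp_apply _ _ _ _ b
  · rintro ⟨d, rfl⟩
    ext a
    change d (g (f a)) = 0
    rw [h.apply_apply_eq_zero, map_zero]

end CharacterModule

/-- Over a Noetherian ring, the character module of an injective module is flat. -/
lemma Module.Injective.flat_characterModule [IsNoetherianRing R] (E : Type u) [AddCommGroup E]
    [Module R E] [Module.Injective R E] : Module.Flat R (CharacterModule E) := by
  refine Module.Flat.of_forall_isTrivialRelation fun {l f x} hfx ↦ ?_
  let φ : (Fin l → R) →ₗ[R] R := Fintype.linearCombination R f
  obtain ⟨k, s, hs⟩ := Submodule.fg_iff_exists_fin_generating_family.1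
    (IsNoetherian.noetherian (LinearMap.ker φ))
  let α : E →ₗ[R] (Fin l → E) := LinearMap.pi fun i ↦ LinearMap.lsmul R E (f i)
  let β : (Fin l → E) →ₗ[R] (Fin k → E) :=
    LinearMap.pi fun j ↦ ∑ i, s j i • LinearMap.proj i
  have hsφ (j : Fin k) : ∑ i, f i * s j i = 0 := by
    have : s j ∈ LinearMap.ker φ := hs ▸ Submodule.subset_span ⟨j, rfl⟩
    simpa [φ, Fintype.linearCombination_apply, mul_comm] using this
  have hexact : Function.Exact α β := by
    refine fun e ↦ ⟨fun he ↦ ?_, ?_⟩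
    · let g : (Fin l → R) →ₗ[R] E := Fintype.linearCombination R e
      have hg : LinearMap.ker φ ≤ LinearMap.ker g := by
        rw [← hs, Submodule.span_le]
        rintro _ ⟨j, rfl⟩
        simpa [β, g, Fintype.linearCombination_apply] using congr_fun he j
      obtain ⟨h, hh⟩ := Module.Injective.out ((LinearMap.ker φ).liftQ φ le_rfl)
        (LinearMap.ker_eq_bot.1 (Submodule.ker_liftQ_eq_bot _ _ _ le_rfl))
        ((LinearMap.ker φ).liftQ g hg)
      refine ⟨h 1, ?_⟩
      ext i
      have := hh (Submodule.Quotient.mk (Pi.single i 1))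
      simp only [Submodule.liftQ_apply, φ, g, Fintype.linearCombination_apply_single,
        one_smul] at this
      simp [α, ← this, ← map_smul]
    · rintro ⟨e, rfl⟩
      ext j
      simp [α, β, smul_smul, ← Finset.sum_smul, mul_comm (s j _), hsφ j]
  let X : CharacterModule (Fin l → E) := ∑ i, CharacterModule.dual (LinearMap.proj (R := R) i) (x i)
  obtain ⟨y, hy⟩ := (CharacterModule.dual_exact hexact X).1 (by
    rw [← hfx]
    simp only [X, map_sum]
    refine Finset.sum_congr rfl fun i _ ↦ ?_
    ext e
    rfl)
  refine ⟨k, fun i j ↦ s j i,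
    fun j ↦ CharacterModule.dual (LinearMap.single R (fun _ : Fin k ↦ E) j) y, ?_, hsφ⟩
  intro i
  have hX : x i = CharacterModule.dual (LinearMap.single R (fun _ : Fin l ↦ E) i) X := by
    simp only [X, map_sum]
    rw [Finset.sum_eq_single i]
    · ext e
      change x i e = x i ((Pi.single i e : Fin l → E) i)
      simp
    · intro b _ hb
      ext e
      change x b ((Pi.single i e : Fin l → E) b) = 0
      simp [Pi.single_eq_of_ne hb]
    · simp
  rw [hX, ← hy, ← LinearMap.comp_apply, ← CharacterModule.dual_comp]
  have : β ∘ₗ LinearMap.single R (fun _ : Fin l ↦ E) i =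
      ∑ j, s j i • LinearMap.single R (fun _ : Fin k ↦ E) j := by
    ext e j
    simp [β, Pi.single_apply, Finset.sum_apply]
  rw [this]
  ext e
  let ev : CharacterModule E →+ AddCircle (1 : ℚ) :=
    { toFun := fun c ↦ c e, map_zero' := rfl, map_add' := fun _ _ ↦ rfl }
  change y ((∑ j, s j i • LinearMap.single R (fun _ : Fin k ↦ E) j) e) =
    ev (∑ j, s j i • CharacterModule.dual (LinearMap.single R (fun _ : Fin k ↦ E) j) y)
  rw [LinearMap.sum_apply, map_sum, map_sum]
  refine Finset.sum_congr rfl fun j _ ↦ ?_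
  exact congr_arg y (map_smul (LinearMap.single R (fun _ : Fin k ↦ E) j) _ _).symm

namespace CategoryTheory

variable {C : Type*} [Category* C] [Abelian C]

lemma ShortComplex.Exact.shortExact_kernel {S : ShortComplex C} (hS : S.Exact) :
    (ShortComplex.mk (kernel.ι S.f) (kernel.lift S.g S.f S.zero)
      (by simp [← cancel_mono (kernel.ι S.g)])).ShortExact where
  exact := by
    let φ : ShortComplex.mk (kernel.ι S.f) (kernel.lift S.g S.f S.zero)
        (by simp [← cancel_mono (kernel.ι S.g)]) ⟶
        ShortComplex.mk (kernel.ι S.f) S.f (kernel.condition S.f) :=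
      { τ₁ := 𝟙 _, τ₂ := 𝟙 _, τ₃ := kernel.ι S.g }
    exact (ShortComplex.exact_iff_of_epi_of_isIso_of_mono φ).2 (ShortComplex.exact_kernel S.f)
  epi_g := hS.epi_kernelLift

lemma ShortComplex.Exact.shortExact_cokernel {S : ShortComplex C} (hS : S.Exact) :
    (ShortComplex.mk (cokernel.desc S.f S.g S.zero) (cokernel.π S.g)
      (by simp [← cancel_epi (cokernel.π S.f)])).ShortExact where
  exact := by
    let φ : ShortComplex.mk S.g (cokernel.π S.g) (cokernel.condition S.g) ⟶
        ShortComplex.mk (cokernel.desc S.f S.g S.zero) (cokernel.π S.g)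
          (by simp [← cancel_epi (cokernel.π S.f)]) :=
      { τ₁ := cokernel.π S.f, τ₂ := 𝟙 _, τ₃ := 𝟙 _ }
    exact (ShortComplex.exact_iff_of_epi_of_isIso_of_mono φ).1 (ShortComplex.exact_cokernel S.g)
  mono_f := hS.mono_cokernelDesc

lemma hasInjectiveDimensionLT_kernel_d {J : CochainComplex C ℕ} {n : ℕ}
    (hJ : ∀ i, Injective (J.X i)) (hn : ∀ i, n < i → IsZero (J.X i))
    (hex : ∀ i, (ShortComplex.mk (J.d i (i + 1)) (J.d (i + 1) (i + 2))
      (J.d_comp_d i (i + 1) (i + 2))).Exact) (m i : ℕ) (h : n + 1 ≤ i + m) :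
    HasInjectiveDimensionLT (kernel (J.d i (i + 1))) m := by
  induction m generalizing i with
  | zero =>
    have : IsZero (kernel (J.d i (i + 1))) := (hn i (by lia)).of_mono (kernel.ι _)
    exact this.hasInjectiveDimensionLT_zero
  | succ m ih =>
    have := hJ i
    exact (hex i).shortExact_kernel.hasInjectiveDimensionLT_X₁ m (ih (i + 1) (by lia))
      (inferInstanceAs (HasInjectiveDimensionLT (J.X i) (m + 1)))

lemma hasProjectiveDimensionLT_cokernel_d {P : ChainComplex C ℕ} {n : ℕ}
    (hP : ∀ i, Projective (P.X i)) (hn : ∀ i, n < i → IsZero (P.X i))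
    (hex : ∀ i, (ShortComplex.mk (P.d (i + 2) (i + 1)) (P.d (i + 1) i)
      (P.d_comp_d (i + 2) (i + 1) i)).Exact) (m i : ℕ) (h : n + 1 ≤ i + m) :
    HasProjectiveDimensionLT (cokernel (P.d (i + 1) i)) m := by
  induction m generalizing i with
  | zero =>
    have : IsZero (cokernel (P.d (i + 1) i)) := (hn i (by lia)).of_epi (cokernel.π _)
    exact this.hasProjectiveDimensionLT_zero
  | succ m ih =>
    have := hP i
    exact (hex i).shortExact_cokernel.hasProjectiveDimensionLT_X₃ m (ih (i + 1) (by lia))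
      (inferInstanceAs (HasProjectiveDimensionLT (P.X i) (m + 1)))

end CategoryTheory

lemma HasFiniteInjectiveDimension.exists_hasInjectiveDimensionLT {M : ModuleCat.{u} R}
    (h : HasFiniteInjectiveDimension M) : ∃ n, HasInjectiveDimensionLT M n := by
  obtain ⟨n, J, ι, hJ, hn, hι, w, h₀, hex⟩ := h
  have := hasInjectiveDimensionLT_kernel_d
    (fun i ↦ have := hJ i; Module.injective_object_of_injective_module R (J.X i)) hn hex
    (n + 1) 0 (by lia)
  exact ⟨n + 1, hasInjectiveDimensionLT_of_iso (X := kernel (J.d 0 1))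
    ((kernelIsKernel (J.d 0 1)).conePointUniqueUpToIso h₀.fIsKernel) _⟩

lemma HasFiniteProjectiveDimension.exists_hasProjectiveDimensionLT {M : ModuleCat.{u} R}
    (h : HasFiniteProjectiveDimension M) : ∃ n, HasProjectiveDimensionLT M n := by
  obtain ⟨n, P, π, hP, hn, hπ, w, h₀, hex⟩ := h
  have := hasProjectiveDimensionLT_cokernel_d
    (fun i ↦ (IsProjective.iff_projective (P.X i)).1 (hP i)) hn hex (n + 1) 0 (by lia)
  exact ⟨n + 1, hasProjectiveDimensionLT_of_iso (X := cokernel (P.d 1 0))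
    ((cokernelIsCokernel (P.d 1 0)).coconePointUniqueUpToIso h₀.gIsCokernel) _⟩

lemma HasFiniteProjectiveDimension.of_shortExact {S : ShortComplex (ModuleCat.{u} R)}
    (hS : S.ShortExact) (h₂ : Projective S.X₂) (h₁ : HasFiniteProjectiveDimension S.X₁) :
    HasFiniteProjectiveDimension S.X₃ := by
  obtain ⟨n, P, π, hP, hn, hπ, w, h₀, hex⟩ := h₁
  have := hS.mono_f
  have hw : P.d 1 0 ≫ π ≫ S.f = 0 := by rw [reassoc_of% w, zero_comp]
  have hπS : (π ≫ S.f) ≫ S.g = 0 := by simp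
  refine ⟨n + 1, P.augment (π ≫ S.f) hw, S.g, ?_, ?_, hS.epi_g, hπS, ?_, ?_⟩
  · rintro (_ | i)
    · exact (IsProjective.iff_projective S.X₂).2 h₂
    · exact hP i
  · rintro (_ | i) hi
    · lia
    · exact hn i (by lia)
  · let φ : ShortComplex.mk (π ≫ S.f) S.g hπS ⟶ S := { τ₁ := π, τ₂ := 𝟙 _, τ₃ := 𝟙 _ }
    exact (ShortComplex.exact_iff_of_epi_of_isIso_of_mono φ).2 hS.exact
  · rintro (_ | i)
    · let φ : ShortComplex.mk (P.d 1 0) π w ⟶ ShortComplex.mk (P.d 1 0) (π ≫ S.f) hw :=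
        { τ₁ := 𝟙 _, τ₂ := 𝟙 _, τ₃ := S.f }
      exact (ShortComplex.exact_iff_of_epi_of_isIso_of_mono φ).1 h₀
    · exact hex i

lemma HasFiniteProjectiveDimension.of_isZero {M : ModuleCat.{u} R} (hM : IsZero M) :
    HasFiniteProjectiveDimension M := by
  have : Projective M := hM.projective
  refine ⟨0, { X := fun _ ↦ M, d := fun _ _ ↦ 0 }, 𝟙 M,
    fun i ↦ (IsProjective.iff_projective M).2 this, fun i _ ↦ hM, inferInstance, by simp, ?_,
    fun i ↦ ?_⟩
  · exact ShortComplex.exact_of_isZero_X₂ _ hM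
  · exact ShortComplex.exact_of_isZero_X₂ _ hM

open ZeroObject in
lemma HasFiniteProjectiveDimension.of_hasProjectiveDimensionLT {M : ModuleCat.{u} R} (n : ℕ)
    [HasProjectiveDimensionLT M n] : HasFiniteProjectiveDimension M := by
  induction n generalizing M with
  | zero => exact .of_isZero (isZero_of_hasProjectiveDimensionLT_zero M)
  | succ n ih =>
    have hS := ModuleCat.shortExact_projectiveShortComplex M
    have h₂ : Projective (ModuleCat.projectiveShortComplex M).X₂ :=
      ModuleCat.projective_of_categoryTheory_projective _
    cases n with
    | zero =>
      have : Projective M := projective_iff_hasProjectiveDimensionLT_one.2 ‹_›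
      exact .of_shortExact (S := ShortComplex.mk (0 : 0 ⟶ M) (𝟙 M) zero_comp)
        { exact := (ShortComplex.exact_iff_mono _ rfl).2 inferInstance
          mono_f := ⟨fun _ _ _ ↦ (isZero_zero _).eq_of_tgt _ _⟩ } this (.of_isZero (isZero_zero _))
    | succ n =>
      have : HasProjectiveDimensionLT (ModuleCat.projectiveShortComplex M).X₁ (n + 1) :=
        (hS.hasProjectiveDimensionLT_X₃_iff n h₂).1 ‹_›
      exact .of_shortExact hS h₂ ih

open Abelian in
/-- Over a Noetherian ring, vanishing of `Ext(M, R)` for finitely generated `M` propagates to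
vanishing of `Ext(M, F)` for flat `F`. -/
lemma Module.Flat.subsingleton_ext [IsNoetherianRing R] (F : ModuleCat.{u} R) [Module.Flat R F]
    (n : ℕ) (M : ModuleCat.{u} R) [Module.Finite R M]
    (h : Subsingleton (Ext.{u} M (ModuleCat.of R R) (n + 1))) :
    Subsingleton (Ext.{u} M F (n + 1)) := by
  obtain ⟨k, f, hf⟩ := Module.Finite.exists_fin' R M
  have hS := LinearMap.shortExact_shortComplexKer hf
  have : Module.Finite R f.shortComplexKer.X₁ :=
    inferInstanceAs (Module.Finite R (LinearMap.ker f))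
  have : CategoryTheory.Projective f.shortComplexKer.X₂ :=
    (IsProjective.iff_projective _).1 (inferInstanceAs (Module.Projective R (Fin k → R)))
  induction n generalizing M k with
  | zero =>
    refine Ext.subsingleton_ext_one_of_forall_extension hS fun φ ↦ ?_
    have : Module.FinitePresentation R f.shortComplexKer.X₁ :=
      Module.finitePresentation_of_finite R _
    obtain ⟨l, a, b, hab⟩ := exists_factorization_of_finitePresentation φ.hom
    have ext (j : Fin l) := Ext.exists_extension_of_subsingleton hS h
      (ModuleCat.ofHom (Finsupp.lapply j ∘ₗ a))
    choose ψ hψ using ext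
    let ψ' : f.shortComplexKer.X₂ →ₗ[R] (Fin l →₀ R) :=
      (Finsupp.linearEquivFunOnFinite R R (Fin l)).symm.toLinearMap ∘ₗ
        LinearMap.pi fun j ↦ (ψ j).hom
    refine ⟨ModuleCat.ofHom (b ∘ₗ ψ'), ?_⟩
    ext x
    have hx : ψ' (f.shortComplexKer.f x) = a x := by
      ext j
      exact congr(($(hψ j)).hom x)
    change b (ψ' (f.shortComplexKer.f x)) = φ.hom x
    rw [hx, hab, LinearMap.comp_apply]
  | succ n ih =>
    have h₁ : Subsingleton (Ext.{u} f.shortComplexKer.X₁ (ModuleCat.of R R) (n + 1)) :=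
      Ext.subsingleton_contravariant_X₁_of_X₃ hS (add_comm _ _)
        (Ext.subsingleton_of_projective _ _ n) h
    obtain ⟨l, g, hg⟩ := Module.Finite.exists_fin' R f.shortComplexKer.X₁
    exact Ext.subsingleton_contravariant_X₃_of_X₁ hS (add_comm _ _)
      (Ext.subsingleton_of_projective _ _ (n + 1)) (ih f.shortComplexKer.X₁ h₁ l g hg
        (LinearMap.shortExact_shortComplexKer hg)
        (inferInstanceAs (Module.Finite R (LinearMap.ker g)))
        ((IsProjective.iff_projective _).1 (inferInstanceAs (Module.Projective R (Fin l → R)))))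

open Abelian in
/-- The Baer criterion for injective dimension. -/
lemma hasInjectiveDimensionLT_of_forall_ideal (n : ℕ) (M : ModuleCat.{u} R)
    (h : ∀ I : Ideal R, Subsingleton (Ext.{u} (ModuleCat.of R (R ⧸ I)) M (n + 1))) :
    HasInjectiveDimensionLT M (n + 1) := by
  induction n generalizing M with
  | zero =>
    rw [zero_add, ← injective_iff_hasInjectiveDimensionLT_one]
    refine (Module.injective_iff_injective_object R M).1 (Module.Baer.iff_injective.1 fun I g ↦ ?_)
    have hS : (ModuleCat.shortComplexOfCompEqZero I.subtype I.mkQ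
        (LinearMap.exact_subtype_mkQ I).linearMap_comp_eq_zero).ShortExact :=
      ModuleCat.shortComplex_shortExact _ (LinearMap.exact_subtype_mkQ I)
        (Submodule.subtype_injective I) I.mkQ_surjective
    obtain ⟨ψ, hψ⟩ := Ext.exists_extension_of_subsingleton hS (h I) (ModuleCat.ofHom g)
    exact ⟨ψ.hom, fun x hx ↦ congr($hψ ⟨x, hx⟩)⟩
  | succ n ih =>
    let ⟨p⟩ := EnoughInjectives.presentation M
    have hS : (ShortComplex.mk _ _ (cokernel.condition p.f)).ShortExact :=
      { exact := ShortComplex.exact_cokernel p.f }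
    exact (hS.hasInjectiveDimensionLT_X₃_iff n p.injective).1 (ih _ fun I ↦
      Ext.subsingleton_X₃_of_X₁ hS rfl (Ext.subsingleton_of_injective _ _ n) (h I))

/-- Over a Noetherian ring `R`, the injective dimension of a flat module is bounded by that
of `R`. -/
lemma Module.Flat.hasInjectiveDimensionLT [IsNoetherianRing R] (F : ModuleCat.{u} R)
    [Module.Flat R F] (d : ℕ) [HasInjectiveDimensionLT (ModuleCat.of R R) (d + 1)] :
    HasInjectiveDimensionLT F (d + 1) :=
  hasInjectiveDimensionLT_of_forall_ideal d F fun I ↦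
    subsingleton_ext F d (ModuleCat.of R (R ⧸ I))
      (HasInjectiveDimensionLT.subsingleton _ (d + 1) _ le_rfl _)

namespace CategoryTheory.ShortComplex.ShortExact

variable {S : ShortComplex (ModuleCat.{u} R)}

lemma exists_characterModule (hS : S.ShortExact) :
    ∃ w, (ShortComplex.mk (ModuleCat.ofHom (CharacterModule.dual S.g.hom))
      (ModuleCat.ofHom (CharacterModule.dual S.f.hom)) w).ShortExact := by
  have h := CharacterModule.dual_exact ((moduleCat_exact_iff_function_exact S).1 hS.exact)
  refine ⟨ModuleCat.hom_ext h.linearMap_comp_eq_zero, ModuleCat.shortComplex_shortExact _ h ?_ ?_⟩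
  · exact CharacterModule.dual_injective_of_surjective _ hS.moduleCat_surjective_g
  · exact CharacterModule.dual_surjective_of_injective _ hS.moduleCat_injective_f

lemma flat_X₁ (hS : S.ShortExact) (h₂ : Module.Flat R S.X₂) (h₃ : Module.Flat R S.X₃) :
    Module.Flat R S.X₁ := by
  obtain ⟨w, hw⟩ := hS.exists_characterModule
  rw [Module.Flat.iff_characterModule_injective] at h₂ h₃ ⊢
  refine (Module.injective_iff_injective_object R _).2 ?_
  have := (Module.injective_iff_injective_object R _).1 h₂
  have := (Module.injective_iff_injective_object R _).1 h₃
  exact injective_iff_hasInjectiveDimensionLT_one.2 <|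
    hw.hasInjectiveDimensionLT_X₃ 1
      (inferInstanceAs (HasInjectiveDimensionLT (ModuleCat.of R (CharacterModule S.X₂)) 1))
      (inferInstanceAs (HasInjectiveDimensionLT (ModuleCat.of R (CharacterModule S.X₃)) (1 + 1)))

end CategoryTheory.ShortComplex.ShortExact

open Abelian in
/-- If `Ext(M, F)` vanishes in degree `n + 1` for a flat module `M` and every flat module `F`, then
`M` has projective dimension at most `n`. -/
lemma Module.Flat.hasProjectiveDimensionLT_of_ext (n : ℕ) (M : ModuleCat.{u} R) [Module.Flat R M]
    (h : ∀ F : ModuleCat.{u} R, Module.Flat R F → Subsingleton (Ext.{u} M F (n + 1))) :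
    HasProjectiveDimensionLT M (n + 1) := by
  have hS := ModuleCat.shortExact_projectiveShortComplex M
  have : CategoryTheory.Projective M.projectiveShortComplex.X₂ :=
    ModuleCat.projective_of_categoryTheory_projective _
  have hK : Module.Flat R M.projectiveShortComplex.X₁ := hS.flat_X₁ inferInstance ‹_›
  induction n generalizing M with
  | zero =>
    obtain ⟨s, hs⟩ := Ext.exists_lift_of_subsingleton hS (h _ hK) (𝟙 M)
    have : CategoryTheory.Projective M := Retract.projective ⟨s, M.projectiveShortComplex.g, hs⟩
    infer_instance
  | succ n ih =>
    refine (hS.hasProjectiveDimensionLT_X₃_iff n this).2 (ih _ (fun F hF ↦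
      Ext.subsingleton_contravariant_X₁_of_X₃ hS (add_comm _ _)
        (Ext.subsingleton_of_projective _ _ n) (h F hF))
      (ModuleCat.shortExact_projectiveShortComplex _)
      (ModuleCat.projective_of_categoryTheory_projective _)
      ((ModuleCat.shortExact_projectiveShortComplex _).flat_X₁ inferInstance hK))

section

variable [IsNoetherianRing R] (d : ℕ) [HasInjectiveDimensionLT (ModuleCat.of R R) (d + 1)]

lemma Module.Flat.hasProjectiveDimensionLT (M : ModuleCat.{u} R) [Module.Flat R M] :
    HasProjectiveDimensionLT M (d + 1) :=
  hasProjectiveDimensionLT_of_ext d M fun F _ ↦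
    have := hasInjectiveDimensionLT F d
    HasInjectiveDimensionLT.subsingleton F (d + 1) _ le_rfl M

lemma hasProjectiveDimensionLT_of_characterModule (n : ℕ) (M : ModuleCat.{u} R)
    (h : HasInjectiveDimensionLT (ModuleCat.of R (CharacterModule M)) (n + 1)) :
    HasProjectiveDimensionLT M (d + n + 1) := by
  induction n generalizing M with
  | zero =>
    have : Module.Flat R M := Module.Flat.iff_characterModule_injective.2 <|
      (Module.injective_iff_injective_object R _).2 <|
        injective_iff_hasInjectiveDimensionLT_one.2 h
    exact Module.Flat.hasProjectiveDimensionLT d M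
  | succ n ih =>
    have hS := ModuleCat.shortExact_projectiveShortComplex M
    have h₂ : Projective M.projectiveShortComplex.X₂ :=
      ModuleCat.projective_of_categoryTheory_projective _
    obtain ⟨w, hw⟩ := hS.exists_characterModule
    have hI : Injective (ModuleCat.of R (CharacterModule M.projectiveShortComplex.X₂)) :=
      (Module.injective_iff_injective_object R _).1
        (Module.Flat.iff_characterModule_injective.1 inferInstance)
    exact (hS.hasProjectiveDimensionLT_X₃_iff (d + n) h₂).2
      (ih _ ((hw.hasInjectiveDimensionLT_X₃_iff n hI).2 h))

lemma CategoryTheory.Injective.hasProjectiveDimensionLT (E : ModuleCat.{u} R) [Injective E] :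
    HasProjectiveDimensionLT E (d + d + 1) := by
  have := Module.injective_module_of_injective_object R E
  have : Module.Flat R (ModuleCat.of R (CharacterModule E)) :=
    Module.Injective.flat_characterModule E
  exact hasProjectiveDimensionLT_of_characterModule d d E
    (Module.Flat.hasInjectiveDimensionLT _ d)

end

/-- `IsCosyzygy n M C` expresses that there is an exact sequence
`0 → M → I⁰ → ⋯ → Iⁿ⁻¹ → C → 0` with injective modules `Iⁱ`. -/
inductive IsCosyzygy : ℕ → ModuleCat.{u} R → ModuleCat.{u} R → Prop
  | zero (M : ModuleCat.{u} R) : IsCosyzygy 0 M M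
  | succ {n : ℕ} {M I M' C : ModuleCat.{u} R} {f : M ⟶ I} {g : I ⟶ M'} {w : f ≫ g = 0}
      (hS : (ShortComplex.mk f g w).ShortExact) (hI : Injective I) (h : IsCosyzygy n M' C) :
      IsCosyzygy (n + 1) M C

lemma ModuleCat.exists_shortExact_injective (M : ModuleCat.{u} R) :
    ∃ (I M' : ModuleCat.{u} R) (f : M ⟶ I) (g : I ⟶ M') (w : f ≫ g = 0),
      (ShortComplex.mk f g w).ShortExact ∧ Injective I :=
  let ⟨p⟩ := EnoughInjectives.presentation M
  ⟨_, _, p.f, _, cokernel.condition p.f, { exact := ShortComplex.exact_cokernel p.f }, p.injective⟩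

/-- The inductive step of the horseshoe lemma. -/
lemma ModuleCat.exists_horseshoe {A B C I J A' C' : ModuleCat.{u} R}
    {f : A ⟶ B} {g : B ⟶ C} {w : f ≫ g = 0} (hS : (ShortComplex.mk f g w).ShortExact)
    {a : A ⟶ I} {a' : I ⟶ A'} {wa : a ≫ a' = 0} (ha : (ShortComplex.mk a a' wa).ShortExact)
    {c : C ⟶ J} {c' : J ⟶ C'} {wc : c ≫ c' = 0} (hc : (ShortComplex.mk c c' wc).ShortExact)
    (hI : Injective I) (hJ : Injective J) :
    ∃ (K B' : ModuleCat.{u} R) (b : B ⟶ K) (b' : K ⟶ B') (wb : b ≫ b' = 0)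
      (f' : A' ⟶ B') (g' : B' ⟶ C') (w' : f' ≫ g' = 0), Injective K ∧
        (ShortComplex.mk b b' wb).ShortExact ∧ (ShortComplex.mk f' g' w').ShortExact := by
  have := hS.mono_f
  obtain ⟨i, hi⟩ : ∃ i : B ⟶ I, f ≫ i = a := ⟨_, Injective.comp_factorThru a f⟩
  have hif (x : A) : i.hom (f.hom x) = a.hom x := congr(($hi).hom x)
  have hfg := (ShortComplex.ShortExact.moduleCat_exact_iff_function_exact _).1 hS.exact
  have hf := hS.moduleCat_injective_f
  have hg := hS.moduleCat_surjective_g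
  have haa' := (ShortComplex.ShortExact.moduleCat_exact_iff_function_exact _).1 ha.exact
  have ha' := ha.moduleCat_surjective_g
  have hcc' := (ShortComplex.ShortExact.moduleCat_exact_iff_function_exact _).1 hc.exact
  have hc₁ := hc.moduleCat_injective_f
  have hc' := hc.moduleCat_surjective_g
  have ha₁ := ha.moduleCat_injective_f
  dsimp only at hfg hf hg haa' ha' hcc' hc₁ hc' ha₁
  let b : B →ₗ[R] I × J := i.hom.prod (c.hom ∘ₗ g.hom)
  have hb : Function.Injective b := by
    rw [injective_iff_map_eq_zero]
    intro x hx
    have h₁ : i.hom x = 0 := congr_arg Prod.fst hx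
    have h₂ : c.hom (g.hom x) = 0 := congr_arg Prod.snd hx
    obtain ⟨y, rfl⟩ := (hfg x).1 ((injective_iff_map_eq_zero _).1 hc₁ _ h₂)
    change i.hom (f.hom y) = 0 at h₁
    rw [hif] at h₁
    rw [(injective_iff_map_eq_zero _).1 ha₁ _ h₁, map_zero]
  let φ : I →ₗ[R] (I × J) ⧸ LinearMap.range b :=
    (LinearMap.range b).mkQ ∘ₗ LinearMap.inl R I J
  have hφ : a ≫ ModuleCat.ofHom φ = 0 := by
    ext x
    refine (Submodule.Quotient.mk_eq_zero _).2 ⟨f.hom x, Prod.ext (hif x) ?_⟩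
    change c.hom (g.hom (f.hom x)) = 0
    rw [hfg.apply_apply_eq_zero, map_zero]
  have := ha.epi_g
  obtain ⟨f', hf'⟩ : ∃ f' : A' ⟶ ModuleCat.of R ((I × J) ⧸ LinearMap.range b),
      a' ≫ f' = ModuleCat.ofHom φ := ⟨ha.exact.desc _ hφ, ha.exact.g_desc _ hφ⟩
  have hf'' (x : I) : f'.hom (a'.hom x) = Submodule.Quotient.mk (x, 0) := congr(($hf').hom x)
  let g' : (I × J) ⧸ LinearMap.range b →ₗ[R] C' :=
    (LinearMap.range b).liftQ (c'.hom ∘ₗ LinearMap.snd R I J) <| by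
      rintro _ ⟨x, rfl⟩
      exact hcc'.apply_apply_eq_zero _
  have hg' (x : I × J) : g' (Submodule.Quotient.mk x) = c'.hom x.2 := rfl
  have hfg' : Function.Exact f'.hom g' := by
    refine fun y ↦ ⟨fun hy ↦ ?_, ?_⟩
    · obtain ⟨⟨u, v⟩, rfl⟩ := Submodule.Quotient.mk_surjective _ y
      obtain ⟨z, rfl⟩ := (hcc' v).1 hy
      obtain ⟨x, rfl⟩ := hg z
      refine ⟨a'.hom (u - i.hom x), ?_⟩
      rw [hf'', Submodule.Quotient.eq]
      refine ⟨-x, Prod.ext ?_ ?_⟩ <;> simp [b]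
    · rintro ⟨z, rfl⟩
      obtain ⟨u, rfl⟩ := ha' z
      rw [hf'', hg', map_zero]
  have : Injective (ModuleCat.of R (I × J)) :=
    Injective.of_iso (ModuleCat.biprodIsoProd I J) inferInstance
  refine ⟨ModuleCat.of R (I × J), ModuleCat.of R ((I × J) ⧸ LinearMap.range b), ModuleCat.ofHom b,
    ModuleCat.ofHom (LinearMap.range b).mkQ,
    ModuleCat.hom_ext (LinearMap.exact_map_mkQ_range b).linearMap_comp_eq_zero,
    f', ModuleCat.ofHom g', ModuleCat.hom_ext hfg'.linearMap_comp_eq_zero, this,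
    ModuleCat.shortComplex_shortExact _ (LinearMap.exact_map_mkQ_range b) hb
      (Submodule.mkQ_surjective _), ModuleCat.shortComplex_shortExact _ hfg' ?_ ?_⟩
  · refine (injective_iff_map_eq_zero _).2 fun z hz ↦ ?_
    obtain ⟨u, rfl⟩ := ha' z
    obtain ⟨x, hx⟩ := (Submodule.Quotient.mk_eq_zero _).1 ((hf'' u).symm.trans hz)
    obtain ⟨y, rfl⟩ := (hfg x).1
      ((injective_iff_map_eq_zero _).1 hc₁ _ (congr_arg Prod.snd hx))
    have hu : a.hom y = u := (hif y).symm.trans (congr_arg Prod.fst hx)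
    exact (haa' u).2 ⟨y, hu⟩
  · intro z
    obtain ⟨v, rfl⟩ := hc' z
    exact ⟨Submodule.Quotient.mk (0, v), rfl⟩

namespace IsCosyzygy

variable {n : ℕ} {M C : ModuleCat.{u} R}

lemma exists_isCosyzygy (n : ℕ) (M : ModuleCat.{u} R) : ∃ C, IsCosyzygy n M C := by
  induction n generalizing M with
  | zero => exact ⟨M, .zero M⟩
  | succ n ih =>
    obtain ⟨I, M', f, g, w, hS, hI⟩ := M.exists_shortExact_injective
    obtain ⟨C, hC⟩ := ih M'
    exact ⟨C, .succ hS hI hC⟩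

lemma snoc (h : IsCosyzygy n M C) {I C' : ModuleCat.{u} R} {f : C ⟶ I} {g : I ⟶ C'}
    {w : f ≫ g = 0} (hS : (ShortComplex.mk f g w).ShortExact) (hI : Injective I) :
    IsCosyzygy (n + 1) M C' := by
  induction h with
  | zero => exact .succ hS hI (.zero _)
  | succ hT hJ _ ih => exact .succ hT hJ (ih hS)

open Abelian in
lemma subsingleton_ext_right (h : IsCosyzygy n M C) {X : ModuleCat.{u} R} (k : ℕ) {m : ℕ}
    (hm : k + 1 + n = m) (h₀ : Subsingleton (Ext.{u} X M m)) :
    Subsingleton (Ext.{u} X C (k + 1)) := by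
  induction h generalizing m with
  | zero => exact hm ▸ h₀
  | @succ n M I _ _ _ _ _ hS hI _ ih =>
    exact ih rfl (Ext.subsingleton_X₃_of_X₁ hS hm
      (HasInjectiveDimensionLT.subsingleton I 1 _ (by lia) X) h₀)

open Abelian in
lemma subsingleton_ext_left (h : IsCosyzygy n M C) {X : ModuleCat.{u} R}
    (h₁ : Subsingleton (Ext.{u} X C 1)) : Subsingleton (Ext.{u} X M (n + 1)) := by
  induction h with
  | zero => exact h₁
  | succ hS hI _ ih =>
    exact Ext.subsingleton_X₁_of_X₃ hS rfl (Ext.subsingleton_of_injective _ _ _) (ih h₁)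

lemma injective (h : IsCosyzygy n M C) (hM : HasInjectiveDimensionLT M (n + 1)) :
    Injective C := by
  induction h with
  | zero => exact injective_iff_hasInjectiveDimensionLT_one.2 hM
  | succ hS hI _ ih => exact ih ((hS.hasInjectiveDimensionLT_X₃_iff _ hI).2 hM)

/-- The horseshoe lemma for cosyzygies. -/
lemma exists_shortExact {A A' B C C' : ModuleCat.{u} R} (hA : IsCosyzygy n A A')
    (hC : IsCosyzygy n C C') {f : A ⟶ B} {g : B ⟶ C} {w : f ≫ g = 0}
    (hS : (ShortComplex.mk f g w).ShortExact) :
    ∃ (B' : ModuleCat.{u} R) (f' : A' ⟶ B') (g' : B' ⟶ C') (w' : f' ≫ g' = 0),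
      (ShortComplex.mk f' g' w').ShortExact ∧ IsCosyzygy n B B' := by
  induction hA generalizing B C C' with
  | zero =>
    cases hC
    exact ⟨B, f, g, w, hS, .zero B⟩
  | succ hT hI _ ih =>
    obtain _ | ⟨hT', hI', hC⟩ := hC
    obtain ⟨K, B', b, b', wb, f', g', w', hK, hb, hS'⟩ :=
      ModuleCat.exists_horseshoe hS hT hT' hI hI'
    obtain ⟨B'', f'', g'', w'', hS'', hB⟩ := ih hC hS'
    exact ⟨B'', f'', g'', w'', hS'', .succ hb hK hB⟩

end IsCosyzygy

lemma exists_int_sequence {α : Type*} {r : α → α → Prop} (hleft : ∀ a, ∃ b, r b a)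
    (hright : ∀ a, ∃ b, r a b) (a : α) : ∃ s : ℤ → α, s 1 = a ∧ ∀ k, r (s (k + 1)) (s k) := by
  choose up hup using hleft
  choose down hdown using hright
  let s : ℤ → α
    | .ofNat 0 => down a
    | .ofNat (n + 1) => up^[n] a
    | .negSucc n => down^[n + 2] a
  refine ⟨s, rfl, ?_⟩
  rintro ((_ | n) | (_ | n))
  · exact hdown a
  · change r (up^[n + 1] a) (up^[n] a)
    rw [Function.iterate_succ_apply']
    exact hup _
  · exact hdown (down a)
  · change r (down^[n + 2] a) (down^[n + 3] a)
    rw [Function.iterate_succ_apply' down (n + 2)]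
    exact hdown _

lemma CategoryTheory.ShortComplex.Exact.of_epi_of_mono {C : Type*} [Category* C] [Abelian C]
    {S : ShortComplex C} (hS : S.Exact) {X Y : C} (p : X ⟶ S.X₁) (i : S.X₃ ⟶ Y) [Epi p] [Mono i] :
    (ShortComplex.mk (p ≫ S.f) (S.g ≫ i) (by simp)).Exact := by
  have w' : S.f ≫ S.g ≫ i = 0 := by simp
  let φ : ShortComplex.mk (p ≫ S.f) (S.g ≫ i) (by simp) ⟶ ShortComplex.mk S.f (S.g ≫ i) w' :=
    { τ₁ := p, τ₂ := 𝟙 _, τ₃ := 𝟙 _ }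
  let ψ : S ⟶ ShortComplex.mk S.f (S.g ≫ i) w' := { τ₁ := 𝟙 _, τ₂ := 𝟙 _, τ₃ := i }
  exact (exact_iff_of_epi_of_isIso_of_mono φ).2 ((exact_iff_of_epi_of_isIso_of_mono ψ).1 hS)

open Abelian in
/-- Splicing short exact sequences `0 → C (k + 1) → I k → C k → 0`. -/
lemma IsGorensteinInjective.of_shortExact {C I : ℤ → ModuleCat.{u} R}
    {f : ∀ k, C (k + 1) ⟶ I k} {g : ∀ k, I k ⟶ C k} {w : ∀ k, f k ≫ g k = 0}
    (hS : ∀ k, (ShortComplex.mk (f k) (g k) (w k)).ShortExact) (hI : ∀ k, Injective (I k))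
    (hC : ∀ E : ModuleCat.{u} R, Injective E → ∀ k, Subsingleton (Ext.{u} E (C k) 1)) :
    IsGorensteinInjective (C 1) := by
  have hf (k) : Mono (f k) := (hS k).mono_f
  have hg (k) : Epi (g k) := (hS k).epi_g
  let J : ChainComplex (ModuleCat.{u} R) ℤ :=
    ChainComplex.of I (fun k ↦ g (k + 1) ≫ f k) fun k ↦ by simp [reassoc_of% (w (k + 1))]
  have hd (k : ℤ) : J.d (k + 1) k = g (k + 1) ≫ f k :=
    ChainComplex.of_d I (fun k ↦ g (k + 1) ≫ f k) k
  have hprev (k : ℤ) : (ComplexShape.down ℤ).prev k = k + 1 := by simp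
  have hnext (k : ℤ) : (ComplexShape.down ℤ).next (k + 1) = k := by simp
  refine ⟨J, fun k ↦ Module.injective_module_of_injective_object R (I k), fun n ↦ ?_,
    fun E hE n ↦ ?_, ⟨?_⟩⟩
  · obtain ⟨k, rfl⟩ : ∃ k, n = k + 1 := ⟨n - 1, by simp⟩
    rw [J.exactAt_iff' _ _ _ (hprev _) (hnext k)]
    exact ShortComplex.exact_of_iso (ShortComplex.isoMk (Iso.refl (I (k + 1 + 1)))
      (Iso.refl (I (k + 1))) (Iso.refl (I k))
        (((Category.id_comp _).trans (hd (k + 1))).trans (Category.comp_id _).symm)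
        (((Category.id_comp _).trans (hd k)).trans (Category.comp_id _).symm))
      ((hS (k + 1)).exact.of_epi_of_mono (g (k + 1 + 1)) (f k))
  · obtain ⟨k, rfl⟩ : ∃ k, n = k + 1 := ⟨n - 1, by simp⟩
    rw [HomologicalComplex.exactAt_iff' _ _ _ _ (hprev _) (hnext k), ShortComplex.ab_exact_iff]
    intro x hx
    change E ⟶ I (k + 1) at x
    change x ≫ J.d (k + 1) k = 0 at hx
    have hx' : x ≫ g (k + 1) = 0 := by
      rw [← cancel_mono (f k), Category.assoc, zero_comp, ← hx, hd]
    obtain ⟨z, hz⟩ := Ext.exists_lift_of_subsingleton (hS (k + 1 + 1))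
      (hC E ((Module.injective_iff_injective_object R E).1 hE) _) ((hS (k + 1)).exact.lift x hx')
    refine ⟨z, ?_⟩
    change z ≫ J.d (k + 1 + 1) (k + 1) = x
    rw [hd, reassoc_of% hz]
    exact (hS (k + 1)).exact.lift_f x hx'
  · exact (isKernelCompMono (hS 0).fIsKernel (f (-1)) (hd (-1))).conePointUniqueUpToIso
      (J.cyclesIsKernel 0 (-1) (by simp))

lemma IsCosyzygy.isGorensteinInjective {N : ℕ}
    (hE : ∀ E : ModuleCat.{u} R, Injective E → HasProjectiveDimensionLT E (N + 1))
    (hP : ∀ P : ModuleCat.{u} R, Projective P → HasInjectiveDimensionLT P (N + 1))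
    {M C : ModuleCat.{u} R} (h : IsCosyzygy N M C) : IsGorensteinInjective C := by
  let α := { C : ModuleCat.{u} R // ∃ M, IsCosyzygy N M C }
  let r (C' C : α) : Prop := ∃ (I : ModuleCat.{u} R) (f : C'.1 ⟶ I) (g : I ⟶ C.1) (w : f ≫ g = 0),
    (ShortComplex.mk f g w).ShortExact ∧ Injective I
  have hleft (C : α) : ∃ C', r C' C := by
    obtain ⟨C, M, hM⟩ := C
    have hP₂ : Projective M.projectiveShortComplex.X₂ :=
      ModuleCat.projective_of_categoryTheory_projective _
    obtain ⟨K, hK⟩ := IsCosyzygy.exists_isCosyzygy N M.projectiveShortComplex.X₁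
    obtain ⟨I, f, g, w, hS, hI⟩ := hK.exists_shortExact hM
      (ModuleCat.shortExact_projectiveShortComplex M)
    exact ⟨⟨K, _, hK⟩, I, f, g, w, hS, hI.injective (hP _ hP₂)⟩
  have hright (C : α) : ∃ C', r C C' := by
    obtain ⟨C, M, hM⟩ := C
    obtain ⟨I, C', f, g, w, hS, hI⟩ := C.exists_shortExact_injective
    obtain _ | ⟨_, _, hC'⟩ := hM.snoc hS hI
    exact ⟨⟨C', _, hC'⟩, I, f, g, w, hS, hI⟩
  obtain ⟨s, hs, hr⟩ := exists_int_sequence hleft hright ⟨C, M, h⟩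
  choose I f g w hS hI using hr
  have := IsGorensteinInjective.of_shortExact hS hI fun E hE' k ↦ by
    obtain ⟨M, hM⟩ := (s k).2
    have := hE E hE'
    exact hM.subsingleton_ext_right 0 rfl (HasProjectiveDimensionLT.subsingleton E (N + 1) _
      (by lia) M)
  rwa [hs] at this

open Abelian in
lemma IsGorensteinInjective.subsingleton_ext {G : ModuleCat.{u} R} (hG : IsGorensteinInjective G)
    (T : ModuleCat.{u} R) (n : ℕ) [HasProjectiveDimensionLT T n] :
    Subsingleton (Ext.{u} T G 1) := by
  obtain ⟨J, hJ, hex, -, ⟨e⟩⟩ := hG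
  have hS (k : ℤ) : (ShortComplex.mk (J.d (k + 1 + 1) (k + 1)) (J.d (k + 1) k)
      (J.d_comp_d _ _ _)).Exact :=
    (J.exactAt_iff' _ _ _ (by simp) (by simp)).1 (hex (k + 1))
  have key (m j : ℕ) (k : ℤ) (h : n ≤ j + 1 + m) :
      Subsingleton (Ext.{u} T (kernel (J.d (k + 1) k)) (j + 1)) := by
    induction m generalizing j k with
    | zero => exact HasProjectiveDimensionLT.subsingleton T n _ h _
    | succ m ih =>
      have : Injective (J.X (k + 1 + 1)) := (Module.injective_iff_injective_object R _).1 (hJ _)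
      exact Ext.subsingleton_X₃_of_X₁ (hS k).shortExact_kernel rfl
        (Ext.subsingleton_of_injective T (J.X (k + 1 + 1)) j) (ih (j + 1) (k + 1) (by lia))
  have h₀ := key n 0 (-1) (by lia)
  let e' : J.cycles 0 ≅ kernel (J.d (-1 + 1) (-1)) :=
    (J.cyclesIsKernel 0 (-1) (by simp)).conePointUniqueUpToIso (limit.isLimit _)
  refine subsingleton_of_forall_eq 0 fun x ↦ ?_
  rw [← x.comp_mk₀_id, ← (e ≪≫ e').hom_inv_id, ← Ext.mk₀_comp_mk₀,
    ← Ext.comp_assoc_of_second_deg_zero,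
    Subsingleton.elim (x.comp (Ext.mk₀ (e ≪≫ e').hom) (add_zero 1)) 0, Ext.zero_comp]

section

variable {C : Type*} [Category* C] [Abelian C]

lemma CategoryTheory.ShortComplex.ShortExact.shortExact_pushout {S : ShortComplex C}
    (hS : S.ShortExact) {Y : C} (φ : S.X₁ ⟶ Y) :
    (ShortComplex.mk (pushout.inr S.f φ)
      (pushout.desc S.g 0 (S.zero.trans comp_zero.symm)) (pushout.inr_desc _ _ _)).ShortExact := by
  have := hS.mono_f
  have := hS.epi_g
  have := epi_of_epi_fac (pushout.inl_desc S.g (0 : Y ⟶ S.X₃)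
    (S.zero.trans comp_zero.symm : S.f ≫ S.g = φ ≫ 0))
  refine ⟨ShortComplex.exact_of_g_is_cokernel _ (CokernelCofork.IsColimit.ofπ' _ _
    fun {Z} k hk ↦ ?_)⟩
  have hk' : S.f ≫ pushout.inl S.f φ ≫ k = 0 := by
    rw [pushout.condition_assoc]
    exact (congrArg (φ ≫ ·) hk).trans comp_zero
  refine ⟨hS.exact.desc (pushout.inl S.f φ ≫ k) hk', pushout.hom_ext ?_ ?_⟩
  · exact (pushout.inl_desc_assoc _ _ _ _).trans (hS.exact.g_desc _ _)
  · exact (pushout.inr_desc_assoc _ _ _ _).trans (zero_comp.trans hk.symm)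

open Abelian in
lemma ext1Vanishes_iff_subsingleton_ext [HasExt C] [EnoughProjectives C] (A B : C) :
    Ext1Vanishes A B ↔ Subsingleton (Ext A B 1) := by
  refine ⟨fun h ↦ ?_, fun h E f g w hS ↦ Ext.exists_lift_of_subsingleton hS h (𝟙 A)⟩
  let ⟨p⟩ := EnoughProjectives.presentation A
  have hS : (ShortComplex.mk _ _ (kernel.condition p.f)).ShortExact :=
    { exact := ShortComplex.exact_kernel p.f }
  have : Projective (ShortComplex.mk _ _ (kernel.condition p.f)).X₂ := p.projective
  refine Ext.subsingleton_ext_one_of_forall_extension hS fun φ ↦ ?_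
  have hT := hS.shortExact_pushout φ
  obtain ⟨s, hs⟩ := h _ _ _ _ hT
  let t := ShortComplex.Splitting.ofExactOfSection _ hT.exact s hs hT.mono_f
  refine ⟨pushout.inl _ _ ≫ t.r, ?_⟩
  rw [pushout.condition_assoc]
  exact (congrArg (φ ≫ ·) t.f_r).trans (Category.comp_id φ)

end

theorem ext1_gorensteinInjective_vanishes_iff_finite_projective_dimension
    [IsNoetherianRing R]
    (hGor : HasFiniteInjectiveDimension (ModuleCat.of R R))
    (T : ModuleCat.{u} R) :
    (∀ G : ModuleCat.{u} R, IsGorensteinInjective G → Ext1Vanishes T G) ↔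
      HasFiniteProjectiveDimension T := by
  constructor
  · intro h
    obtain ⟨d, hd⟩ := hGor.exists_hasInjectiveDimensionLT
    have : HasInjectiveDimensionLT (ModuleCat.of R R) (d + 1) :=
      hasInjectiveDimensionLT_of_ge _ d (d + 1) (by lia)
    have : HasProjectiveDimensionLT T (d + d + 1) :=
      hasProjectiveDimensionLT_of_enoughInjectives T (d + d + 1) fun M ↦ by
        obtain ⟨C, hC⟩ := IsCosyzygy.exists_isCosyzygy (d + d) M
        have hG : IsGorensteinInjective C := hC.isGorensteinInjective
          (fun E _ ↦ Injective.hasProjectiveDimensionLT d E) fun P hP ↦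
            have : Module.Projective R P := (IsProjective.iff_projective P).2 hP
            have := Module.Flat.hasInjectiveDimensionLT P d
            hasInjectiveDimensionLT_of_ge P (d + 1) _ (by lia)
        exact hC.subsingleton_ext_left ((ext1Vanishes_iff_subsingleton_ext T C).1 (h C hG))
    exact .of_hasProjectiveDimensionLT (d + d + 1)
  · intro h G hG
    obtain ⟨n, hn⟩ := h.exists_hasProjectiveDimensionLT
    exact (ext1Vanishes_iff_subsingleton_ext T G).2 (hG.subsingleton_ext T n)
end
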